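/- Let Δ be a fan in ℝ^d and σ ∈ Δ a cone. Then the Poincaré polynomial of the simple sheaf based at σ on Δ equals that of the minimal extension sheaf of the link: P(ℒ_σ(Δ)-bar; t) = P(ℒ_{link_Δσ}(link_Δσ)-bar; t). -/

import Mathlib

open scoped Classical

noncomputable section

/-! ### Cones and fans in a real vector space

(The framework is set up over an arbitrary real vector space, so that it applies
both to `ℝ^d` and to the quotient `ℝ^d/Span(σ)` in which the link lives.) -/

variable (V : Type) [AddCommGroup V] [Module ℝ V]

/-- A (polyhedral) cone: the set of nonnegative combinations of finitely many
vectors. -/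
def IsPolyCone (σ : Set V) : Prop :=
  ∃ (n : ℕ) (v : Fin n → V),
    σ = {x | ∃ c : Fin n → ℝ, (∀ i, 0 ≤ c i) ∧ x = ∑ i, c i • v i}

/-- A pointed cone: a polyhedral cone containing no line through the origin. -/
def IsPointedCone (σ : Set V) : Prop :=
  IsPolyCone V σ ∧ ∀ x ∈ σ, -x ∈ σ → x = 0

/-- `τ` is a face of the cone `σ`. -/
def IsFaceOf (τ σ : Set V) : Prop :=
  ∃ w : V →ₗ[ℝ] ℝ, (∀ x ∈ σ, 0 ≤ w x) ∧ τ = {x ∈ σ | w x = 0}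

/-- A fan: a finite collection of pointed cones, closed under taking faces, such
that the intersection of two cones is a face of both. -/
structure Fan where
  cones : Set (Set V)
  finite : cones.Finite
  pointed : ∀ σ ∈ cones, IsPointedCone V σ
  faceClosed : ∀ σ ∈ cones, ∀ τ, IsFaceOf V τ σ → τ ∈ cones
  interFace : ∀ σ ∈ cones, ∀ τ ∈ cones, IsFaceOf V (σ ∩ τ) σ

/-- The dimension of a cone. -/
def coneDim (σ : Set V) : ℕ := Module.finrank ℝ (Submodule.span ℝ σ)

/-- The zero cone. -/
def oCone : Set V := {0}

/-- The fan `⟨σ⟩` generated by a cone: all its faces. -/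
def faces (σ : Set V) : Set (Set V) := {τ | IsFaceOf V τ σ}

/-- The boundary fan `∂σ` of a cone: all its proper faces. -/
def properFaces (σ : Set V) : Set (Set V) := {τ | IsFaceOf V τ σ ∧ τ ≠ σ}

/-- A subfan (= open set in the fan topology). -/
def Subfan (Δ : Fan V) (U : Set (Set V)) : Prop :=
  U ⊆ Δ.cones ∧ ∀ σ ∈ U, ∀ τ, IsFaceOf V τ σ → τ ∈ U

/-! ### Graded modules and sheaves on fans -/

/-- The graded ring of polynomial functions on `V` (generated by the linear
forms, which are homogeneous of degree `1`). -/
abbrev PolyF := MvPolynomial (Module.Dual ℝ V) ℝ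

/-- Evaluation of a polynomial function at a point. -/
def polyEval (x : V) : PolyF V →+* ℝ :=
  MvPolynomial.eval (fun L : Module.Dual ℝ V => L x)

/-- The homogeneous maximal ideal `𝔪` of the ring of polynomial functions. -/
def mId : Ideal (PolyF V) := Ideal.span (Set.range MvPolynomial.X)

/-- The ideal of polynomial functions vanishing on the linear span of `σ`; a
module over `A_σ` is an `A`-module annihilated by it. -/
def vanishingIdeal (σ : Set V) : Set (PolyF V) :=
  {p | ∀ x ∈ Submodule.span ℝ σ, polyEval V x p = 0}

/-- The data of a sheaf of `ℤ_{≥0}`-graded `𝒜`-modules on a fan. -/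
structure SheafData where
  stalk : Set V → Type
  [acg : ∀ σ, AddCommGroup (stalk σ)]
  [modR : ∀ σ, Module ℝ (stalk σ)]
  asmul : ∀ σ, PolyF V → stalk σ → stalk σ
  deg : ∀ σ, ℕ → Submodule ℝ (stalk σ)
  res : ∀ σ τ, stalk σ →ₗ[ℝ] stalk τ

attribute [instance] SheafData.acg SheafData.modR

variable {V}

/-- Sections over a collection of cones: compatible families. -/
def secs (F : SheafData V) (S : Set (Set V)) :
    Submodule ℝ (∀ σ : S, F.stalk σ.1) where
  carrier := {f | ∀ (σ τ : S), IsFaceOf V τ.1 σ.1 → F.res σ.1 τ.1 (f σ) = f τ}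
  add_mem' := by
    intro a b ha hb σ τ h
    simp only [Pi.add_apply, map_add, ha σ τ h, hb σ τ h]
  zero_mem' := by
    intro σ τ h
    simp only [Pi.zero_apply, map_zero]
  smul_mem' := by
    intro c a ha σ τ h
    simp only [Pi.smul_apply, map_smul, ha σ τ h]

/-- The submodule `𝔪·ℱ(S)` of the module of sections. -/
def mSecs (F : SheafData V) (S : Set (Set V)) : Submodule ℝ ↥(secs F S) :=
  Submodule.span ℝ {y | ∃ p ∈ mId V, ∃ z : ↥(secs F S),
    (y : ∀ σ : S, F.stalk σ.1) = fun σ => F.asmul σ.1 p (z.1 σ)}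

/-- The reduction `ℱ(S)‾ = ℱ(S)/𝔪ℱ(S)`. -/
def bar (F : SheafData V) (S : Set (Set V)) := ↥(secs F S) ⧸ mSecs F S

instance (F : SheafData V) (S : Set (Set V)) : AddCommGroup (bar F S) := by
  unfold bar; infer_instance

instance (F : SheafData V) (S : Set (Set V)) : Module ℝ (bar F S) := by
  unfold bar; infer_instance

/-- The quotient map `ρ : ℱ(S) → ℱ(S)‾`. -/
def barQ (F : SheafData V) (S : Set (Set V)) : ↥(secs F S) →ₗ[ℝ] bar F S :=
  (mSecs F S).mkQ

/-- The degree-`n` part of the module of sections. -/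
def degSec (F : SheafData V) (S : Set (Set V)) (n : ℕ) :
    Submodule ℝ ↥(secs F S) :=
  Submodule.comap (secs F S).subtype (Submodule.pi Set.univ fun σ => F.deg σ.1 n)

/-- The Poincaré polynomial `P(ℱ(S)‾; t)`. -/
def PPoly (F : SheafData V) (S : Set (Set V)) : Polynomial ℝ :=
  ∑ᶠ n : ℕ, Polynomial.monomial n
    ((Module.finrank ℝ ↥((degSec F S n).map (barQ F S))) : ℝ)

/-- The sheaf axioms. -/
structure IsSheafOn (F : SheafData V) (Δ : Fan V) : Prop where
  asmul_one : ∀ σ ∈ Δ.cones, ∀ x, F.asmul σ 1 x = x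
  asmul_mul : ∀ σ ∈ Δ.cones, ∀ p q x, F.asmul σ (p * q) x = F.asmul σ p (F.asmul σ q x)
  asmul_add : ∀ σ ∈ Δ.cones, ∀ p q x, F.asmul σ (p + q) x = F.asmul σ p x + F.asmul σ q x
  asmul_dist : ∀ σ ∈ Δ.cones, ∀ p x y, F.asmul σ p (x + y) = F.asmul σ p x + F.asmul σ p y
  asmul_const : ∀ σ ∈ Δ.cones, ∀ (r : ℝ) x, F.asmul σ (MvPolynomial.C r) x = r • x
  annih : ∀ σ ∈ Δ.cones, ∀ p ∈ vanishingIdeal V σ, ∀ x, F.asmul σ p x = 0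
  res_self : ∀ σ ∈ Δ.cones, ∀ x, F.res σ σ x = x
  res_comp : ∀ σ ∈ Δ.cones, ∀ τ γ, IsFaceOf V τ σ → IsFaceOf V γ τ → ∀ x,
    F.res τ γ (F.res σ τ x) = F.res σ γ x
  res_asmul : ∀ σ ∈ Δ.cones, ∀ τ, IsFaceOf V τ σ → ∀ p x,
    F.res σ τ (F.asmul σ p x) = F.asmul τ p (F.res σ τ x)
  deg_internal : ∀ σ ∈ Δ.cones, DirectSum.IsInternal (F.deg σ)
  deg_asmul : ∀ σ ∈ Δ.cones, ∀ (i n : ℕ) (p : PolyF V), p.IsHomogeneous i →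
    ∀ x ∈ F.deg σ n, F.asmul σ p x ∈ F.deg σ (n + i)
  res_deg : ∀ σ ∈ Δ.cones, ∀ τ, IsFaceOf V τ σ → ∀ n, ∀ x ∈ F.deg σ n,
    F.res σ τ x ∈ F.deg τ n

/-- Flabbiness. -/
def Flabby (F : SheafData V) (Δ : Fan V) : Prop :=
  ∀ U U' : Set (Set V), Subfan V Δ U → Subfan V Δ U' → ∀ hVU : U' ⊆ U,
    ∀ f ∈ secs F U', ∃ g ∈ secs F U, ∀ τ : U', g ⟨τ.1, hVU τ.2⟩ = f τ

/-- The stalk at `σ` is a finitely generated free `A_σ`-module. -/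
def FreeStalk (F : SheafData V) (σ : Set V) : Prop :=
  ∃ (n : ℕ) (m : Fin n → F.stalk σ) (j : Fin n → ℕ),
    (∀ i, m i ∈ F.deg σ (j i)) ∧
    (∀ x : F.stalk σ, ∃ a : Fin n → PolyF V, x = ∑ i, F.asmul σ (a i) (m i)) ∧
    (∀ a : Fin n → PolyF V,
      (∑ i, F.asmul σ (a i) (m i)) = 0 ↔ ∀ i, a i ∈ vanishingIdeal V σ)

/-- A pure sheaf on a fan. -/
def IsPureOn (F : SheafData V) (Δ : Fan V) : Prop :=
  IsSheafOn F Δ ∧ Flabby F Δ ∧ ∀ σ ∈ Δ.cones, FreeStalk F σ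

/-- The submodule `𝔪·ℱ(σ)` of a stalk. -/
def mStalk (F : SheafData V) (σ : Set V) : Submodule ℝ (F.stalk σ) :=
  Submodule.span ℝ {y | ∃ p ∈ mId V, ∃ z, y = F.asmul σ p z}

/-- The combined restriction map from a stalk to the boundary. -/
def resFam (F : SheafData V) (σ : Set V) :
    F.stalk σ →ₗ[ℝ] (∀ τ : properFaces V σ, F.stalk τ.1) :=
  LinearMap.pi fun τ => F.res σ τ.1

/-- `𝔪·ℱ(∂σ)` inside the product of the boundary stalks. -/
def mBdry (F : SheafData V) (σ : Set V) :
    Submodule ℝ (∀ τ : properFaces V σ, F.stalk τ.1) :=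
  (mSecs F (properFaces V σ)).map (secs F (properFaces V σ)).subtype

/-- The induced map `ℱ(σ)‾ → ℱ(∂σ)‾` is bijective. -/
def BarResBij (F : SheafData V) (σ : Set V) : Prop :=
  (∀ f ∈ secs F (properFaces V σ), ∃ x : F.stalk σ,
      ∃ m' ∈ mBdry F σ, ∀ τ : properFaces V σ, F.res σ τ.1 x = f τ + m' τ) ∧
  (∀ x : F.stalk σ, resFam F σ x ∈ mBdry F σ → x ∈ mStalk F σ)

/-- `F` is the simple sheaf `ℒ_{σ₀}` based at `σ₀`. -/
def IsSimple (F : SheafData V) (Δ : Fan V) (σ₀ : Set V) : Prop :=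
  IsPureOn F Δ ∧
  (∃ m : F.stalk σ₀, m ∈ F.deg σ₀ 0 ∧ (∀ x, ∃ a : PolyF V, x = F.asmul σ₀ a m) ∧
     ∀ a : PolyF V, F.asmul σ₀ a m = 0 ↔ a ∈ vanishingIdeal V σ₀) ∧
  (∀ τ ∈ Δ.cones, coneDim V τ ≤ coneDim V σ₀ → τ ≠ σ₀ → ∀ x : F.stalk τ, x = 0) ∧
  (∀ τ ∈ Δ.cones, coneDim V σ₀ < coneDim V τ → BarResBij F τ)

/-- The minimal extension sheaf: the simple sheaf based at the zero cone. -/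
def IsMinExt (F : SheafData V) (Δ : Fan V) : Prop := IsSimple F Δ ({0} : Set V)

/-! ### Convex geometry of cones and fans -/

section Geometry

variable {W : Type} [AddCommGroup W] [Module ℝ W]

theorem IsFaceOf.subset {τ σ : Set V} (h : IsFaceOf V τ σ) : τ ⊆ σ := by
  obtain ⟨w, -, rfl⟩ := h
  exact fun x hx => hx.1

theorem IsFaceOf.refl (σ : Set V) : IsFaceOf V σ σ :=
  ⟨0, fun _ _ => le_rfl, by ext x; simp⟩

theorem IsPolyCone.zero_mem {σ : Set V} (h : IsPolyCone V σ) : (0 : V) ∈ σ := by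
  obtain ⟨n, v, rfl⟩ := h
  exact ⟨0, fun _ => le_rfl, by simp⟩

theorem IsPolyCone.add_mem {σ : Set V} (h : IsPolyCone V σ) {x y : V} (hx : x ∈ σ) (hy : y ∈ σ) :
    x + y ∈ σ := by
  obtain ⟨n, v, rfl⟩ := h
  obtain ⟨a, ha, rfl⟩ := hx
  obtain ⟨b, hb, rfl⟩ := hy
  exact ⟨a + b, fun i => add_nonneg (ha i) (hb i), by simp [add_smul, Finset.sum_add_distrib]⟩

theorem IsPolyCone.smul_mem {σ : Set V} (h : IsPolyCone V σ) {r : ℝ} (hr : 0 ≤ r) {x : V}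
    (hx : x ∈ σ) : r • x ∈ σ := by
  obtain ⟨n, v, rfl⟩ := h
  obtain ⟨a, ha, rfl⟩ := hx
  exact ⟨r • a, fun i => mul_nonneg hr (ha i), by simp [Finset.smul_sum, mul_smul]⟩

theorem IsPolyCone.exists_sub_of_mem_span {σ : Set V} (h : IsPolyCone V σ) {v : V}
    (hv : v ∈ Submodule.span ℝ σ) : ∃ a ∈ σ, ∃ b ∈ σ, v = a - b := by
  induction hv using Submodule.span_induction with
  | mem x hx => exact ⟨x, hx, 0, h.zero_mem, by simp⟩
  | zero => exact ⟨0, h.zero_mem, 0, h.zero_mem, by simp⟩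
  | add x y _ _ hx hy =>
    obtain ⟨a, ha, b, hb, rfl⟩ := hx
    obtain ⟨c, hc, e, he, rfl⟩ := hy
    exact ⟨a + c, h.add_mem ha hc, b + e, h.add_mem hb he, by abel⟩
  | smul r x _ hx =>
    obtain ⟨a, ha, b, hb, rfl⟩ := hx
    rcases le_total 0 r with hr | hr
    · exact ⟨r • a, h.smul_mem hr ha, r • b, h.smul_mem hr hb, smul_sub _ _ _⟩
    · have hr' : 0 ≤ -r := by linarith
      exact ⟨(-r) • b, h.smul_mem hr' hb, (-r) • a, h.smul_mem hr' ha, by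
        rw [neg_smul, neg_smul, smul_sub]; abel⟩

theorem IsFaceOf.of_subset_of_subset {σ γ τ : Set V} (h : IsFaceOf V σ τ) (hσγ : σ ⊆ γ)
    (hγτ : γ ⊆ τ) : IsFaceOf V σ γ := by
  obtain ⟨w, hw, hσ⟩ := h
  refine ⟨w, fun x hx => hw x (hγτ hx), ?_⟩
  ext x
  constructor
  · intro hx
    have := hx
    rw [hσ] at this
    exact ⟨hσγ hx, this.2⟩
  · rintro ⟨hx, h0⟩
    rw [hσ]
    exact ⟨hγτ hx, h0⟩

theorem Fan.isFaceOf_of_subset (Δ : Fan V) {σ τ : Set V} (hσ : σ ∈ Δ.cones) (hτ : τ ∈ Δ.cones)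
    (h : σ ⊆ τ) : IsFaceOf V σ τ := by
  have := Δ.interFace τ hτ σ hσ
  rwa [Set.inter_eq_right.2 h] at this

theorem Fan.isFaceOf_trans (Δ : Fan V) {γ σ τ : Set V} (hτ : τ ∈ Δ.cones)
    (h₁ : IsFaceOf V γ σ) (h₂ : IsFaceOf V σ τ) : IsFaceOf V γ τ :=
  Δ.isFaceOf_of_subset (Δ.faceClosed _ (Δ.faceClosed _ hτ _ h₂) _ h₁) hτ
    (h₁.subset.trans h₂.subset)

theorem IsFaceOf.coneDim_lt [FiniteDimensional ℝ V] {τ σ : Set V} (h : IsFaceOf V τ σ)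
    (hne : τ ≠ σ) : coneDim V τ < coneDim V σ := by
  refine Submodule.finrank_lt_finrank_of_lt (lt_of_le_not_ge (Submodule.span_mono h.subset) ?_)
  intro hle
  apply hne
  refine h.subset.antisymm fun x hx => ?_
  obtain ⟨w, -, rfl⟩ := h
  have h1 : Submodule.span ℝ {x ∈ σ | w x = 0} ≤ LinearMap.ker w :=
    Submodule.span_le.2 fun y hy => hy.2
  exact ⟨hx, h1 (hle (Submodule.subset_span hx))⟩

/-- The cones of a fan having `σ` as a face. -/
def Fan.star (Δ : Fan V) (σ : Set V) : Set (Set V) := {τ | τ ∈ Δ.cones ∧ IsFaceOf V σ τ}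

theorem Fan.mem_star_of_isFaceOf (Δ : Fan V) {σ γ τ : Set V} (hγ : γ ∈ Δ.star σ)
    (hτ : τ ∈ Δ.cones) (h : IsFaceOf V γ τ) : τ ∈ Δ.star σ :=
  ⟨hτ, Δ.isFaceOf_trans hτ hγ.2 h⟩

/-- A linear projection `π : V → W` with kernel spanned by the cone `σ`, together with a linear
section `s` and a coordinate system on the kernel. -/
structure ConeSplitting (σ : Set V) (W : Type) [AddCommGroup W] [Module ℝ W] where
  /-- the dimension of the kernel -/
  k : ℕ
  /-- the projection -/
  π : V →ₗ[ℝ] W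
  /-- the section -/
  s : W →ₗ[ℝ] V
  /-- the coordinate vectors of the kernel -/
  e : Fin k → V
  /-- the coordinate functions -/
  x : Fin k → Module.Dual ℝ V
  π_s : ∀ w, π (s w) = w
  e_mem : ∀ i, e i ∈ Submodule.span ℝ σ
  π_eq_zero : ∀ v ∈ Submodule.span ℝ σ, π v = 0
  decomp : ∀ v, v = ∑ i, x i v • e i + s (π v)

theorem exists_coneSplitting [FiniteDimensional ℝ V] (σ : Set V) :
    ∃ S : ConeSplitting σ (V ⧸ Submodule.span ℝ σ), S.π = (Submodule.span ℝ σ).mkQ := by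
  set K := Submodule.span ℝ σ
  obtain ⟨s, hs⟩ := K.mkQ.exists_rightInverse_of_surjective K.range_mkQ
  have hs' : ∀ w, K.mkQ (s w) = w := fun w => LinearMap.congr_fun hs w
  have hK : ∀ v, v - s (K.mkQ v) ∈ K := fun v => by
    have h : K.mkQ (v - s (K.mkQ v)) = 0 := by rw [map_sub, hs', sub_self]
    exact (Submodule.Quotient.mk_eq_zero K).1 h
  let b := Module.finBasis ℝ K
  let p : V →ₗ[ℝ] K := LinearMap.codRestrict K (LinearMap.id - s ∘ₗ K.mkQ) hK
  refine ⟨⟨_, K.mkQ, s, fun i => (b i : V), fun i => b.coord i ∘ₗ p, hs', fun i => (b i).2,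
    fun v hv => by simpa using hv, fun v => ?_⟩, rfl⟩
  have h1 := congrArg (Subtype.val) (b.sum_repr (p v))
  simp only [Submodule.coe_sum, Submodule.coe_smul] at h1
  have h2 : ((p v : K) : V) = v - s (K.mkQ v) := rfl
  rw [h2] at h1
  simp only [LinearMap.comp_apply, Module.Basis.coord_apply]
  rw [h1]; abel

namespace ConeSplitting

variable {σ : Set V} (S : ConeSplitting σ W)

theorem sub_mem (v : V) : v - S.s (S.π v) ∈ Submodule.span ℝ σ := by
  have h : v - S.s (S.π v) = ∑ i, S.x i v • S.e i := sub_eq_iff_eq_add.2 (S.decomp v)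
  rw [h]
  exact Submodule.sum_mem _ fun i _ => Submodule.smul_mem _ _ (S.e_mem i)

theorem functional_eq {w : Module.Dual ℝ V} (hw : ∀ x ∈ σ, w x = 0) (v : V) :
    w (S.s (S.π v)) = w v := by
  have h1 : Submodule.span ℝ σ ≤ LinearMap.ker w := Submodule.span_le.2 hw
  have h2 : w (v - S.s (S.π v)) = 0 := h1 (S.sub_mem v)
  rw [map_sub] at h2
  linarith

theorem isFaceOf_image {γ τ : Set V} (h : IsFaceOf V γ τ) (hσ : σ ⊆ γ) :
    IsFaceOf W (S.π '' γ) (S.π '' τ) := by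
  obtain ⟨w, hw, rfl⟩ := h
  have h0 := S.functional_eq (w := w) fun x hx => (hσ hx).2
  refine ⟨w ∘ₗ S.s, ?_, ?_⟩
  · rintro _ ⟨v, hv, rfl⟩
    simpa [h0] using hw v hv
  · ext y
    constructor
    · rintro ⟨v, hv, rfl⟩
      exact ⟨⟨v, hv.1, rfl⟩, by simpa [h0] using hv.2⟩
    · rintro ⟨⟨v, hv, rfl⟩, hy⟩
      exact ⟨v, ⟨hv, by simpa [h0] using hy⟩, rfl⟩

theorem exists_face_of_isFaceOf_image {τ : Set V} (hσ : IsFaceOf V σ τ) {γ' : Set W}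
    (h : IsFaceOf W γ' (S.π '' τ)) :
    ∃ γ, IsFaceOf V γ τ ∧ IsFaceOf V σ γ ∧ S.π '' γ = γ' := by
  obtain ⟨w, hw, rfl⟩ := h
  have hface : IsFaceOf V {v ∈ τ | w (S.π v) = 0} τ :=
    ⟨w ∘ₗ S.π, fun x hx => hw _ ⟨x, hx, rfl⟩, rfl⟩
  refine ⟨{v ∈ τ | w (S.π v) = 0}, hface, hσ.of_subset_of_subset ?_ hface.subset, ?_⟩
  · intro v hv
    exact ⟨hσ.subset hv, by rw [S.π_eq_zero v (Submodule.subset_span hv), map_zero]⟩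
  · ext y
    constructor
    · rintro ⟨v, hv, rfl⟩
      exact ⟨⟨v, hv.1, rfl⟩, hv.2⟩
    · rintro ⟨⟨v, hv, rfl⟩, hy⟩
      exact ⟨v, ⟨hv, hy⟩, rfl⟩

variable {Δ : Fan V}

theorem subset_of_image_subset {γ τ : Set V} (hγ : γ ∈ Δ.star σ) (hτ : τ ∈ Δ.star σ)
    (h : S.π '' γ ⊆ S.π '' τ) : γ ⊆ τ := by
  have hσΔ : σ ∈ Δ.cones := Δ.faceClosed _ hγ.1 _ hγ.2
  intro v hv
  obtain ⟨v', hv', heq⟩ := h ⟨v, hv, rfl⟩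
  have hk : v' - v ∈ Submodule.span ℝ σ := by
    have := Submodule.sub_mem _ (S.sub_mem v') (S.sub_mem v)
    rw [heq] at this
    simpa using this
  obtain ⟨a, ha, b, hb, hab⟩ := (Δ.pointed σ hσΔ).1.exists_sub_of_mem_span hk
  have hsum : v + a = v' + b := by
    have : v' = v + (a - b) := by rw [← hab]; abel
    rw [this]; abel
  obtain ⟨w, hw, hwe⟩ := Δ.interFace γ hγ.1 τ hτ.1
  have h1 : v + a ∈ γ ∩ τ :=
    ⟨(Δ.pointed γ hγ.1).1.add_mem hv (hγ.2.subset ha), by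
      rw [hsum]; exact (Δ.pointed τ hτ.1).1.add_mem hv' (hτ.2.subset hb)⟩
  have h2 : a ∈ γ ∩ τ := ⟨hγ.2.subset ha, hτ.2.subset ha⟩
  have h3 : v ∈ γ ∩ τ := by
    rw [hwe] at h1 h2 ⊢
    refine ⟨hv, ?_⟩
    have h4 := h1.2
    rw [map_add, h2.2, add_zero] at h4
    exact h4
  exact h3.2

theorem image_injOn : Set.InjOn (fun τ : Set V => S.π '' τ) (Δ.star σ) := fun _ hγ _ hτ h =>
  (S.subset_of_image_subset hγ hτ (Eq.subset h)).antisymm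
    (S.subset_of_image_subset hτ hγ (Eq.subset h.symm))

theorem isFaceOf_of_image {γ τ : Set V} (hγ : γ ∈ Δ.star σ) (hτ : τ ∈ Δ.star σ)
    (h : IsFaceOf W (S.π '' γ) (S.π '' τ)) : IsFaceOf V γ τ :=
  Δ.isFaceOf_of_subset hγ.1 hτ.1 (S.subset_of_image_subset hγ hτ h.subset)

theorem image_self (h0 : (0 : V) ∈ σ) : S.π '' σ = {0} := by
  ext y
  constructor
  · rintro ⟨v, hv, rfl⟩
    exact S.π_eq_zero v (Submodule.subset_span hv)
  · rintro rfl
    exact ⟨0, h0, map_zero _⟩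

theorem s_mem_span {τ : Set V} (hτ : σ ⊆ τ) {w : W} (hw : w ∈ Submodule.span ℝ (S.π '' τ)) :
    S.s w ∈ Submodule.span ℝ τ := by
  rw [Submodule.span_image] at hw
  obtain ⟨v, hv, rfl⟩ := hw
  have h := Submodule.sub_mem _ hv (Submodule.span_mono hτ (S.sub_mem v))
  simpa using h

theorem π_mem_span {τ : Set V} {v : V} (hv : v ∈ Submodule.span ℝ τ) :
    S.π v ∈ Submodule.span ℝ (S.π '' τ) := by
  rw [Submodule.span_image]
  exact ⟨v, hv, rfl⟩

end ConeSplitting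

end Geometry

/-! ### Polynomial functions and projections -/

section Polynomials

variable {W : Type} [AddCommGroup W] [Module ℝ W]

/-- Pullback of polynomial functions along a linear map. -/
def pull (f : V →ₗ[ℝ] W) : PolyF W →ₐ[ℝ] PolyF V := MvPolynomial.rename fun L => L ∘ₗ f

theorem pull_X (f : V →ₗ[ℝ] W) (L : Module.Dual ℝ W) :
    pull f (MvPolynomial.X L) = MvPolynomial.X (L ∘ₗ f) := MvPolynomial.rename_X _ _

theorem polyEval_pull (f : V →ₗ[ℝ] W) (v : V) (p : PolyF W) :
    polyEval V v (pull f p) = polyEval W (f v) p :=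
  MvPolynomial.eval_rename _ _ _

theorem pull_isHomogeneous (f : V →ₗ[ℝ] W) {p : PolyF W} {n : ℕ} (hp : p.IsHomogeneous n) :
    (pull f p).IsHomogeneous n := hp.rename_isHomogeneous

theorem polyEval_zero (p : PolyF V) : polyEval V 0 p = MvPolynomial.constantCoeff p := by
  rw [← MvPolynomial.eval_zero']
  simp [polyEval]

theorem mem_mId_iff (p : PolyF V) : p ∈ mId V ↔ MvPolynomial.constantCoeff p = 0 := by
  rw [mId, ← Set.image_univ, MvPolynomial.mem_ideal_span_X_image, MvPolynomial.constantCoeff_eq,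
    ← MvPolynomial.notMem_support_iff]
  constructor
  · intro h h0
    obtain ⟨i, -, hi⟩ := h 0 h0
    exact hi rfl
  · intro h m hm
    have hm0 : m ≠ 0 := fun h0 => h (h0 ▸ hm)
    obtain ⟨i, hi⟩ := Finsupp.ne_iff.1 hm0
    exact ⟨i, Set.mem_univ _, hi⟩

theorem pull_mem_mId (f : V →ₗ[ℝ] W) {p : PolyF W} (hp : p ∈ mId W) : pull f p ∈ mId V := by
  rw [mem_mId_iff] at *
  rw [← polyEval_zero] at *
  rw [polyEval_pull, map_zero, hp]

theorem constantCoeff_eq_zero_of_mem_vanishingIdeal {σ : Set V} {p : PolyF V}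
    (hp : p ∈ vanishingIdeal V σ) : MvPolynomial.constantCoeff p = 0 := by
  rw [← polyEval_zero]
  exact hp 0 (Submodule.zero_mem _)

namespace ConeSplitting

variable {σ : Set V} (S : ConeSplitting σ W)

/-- Expansion of a polynomial function on `V` as a polynomial in the coordinates of the kernel
with coefficients polynomial functions on `W`. -/
def expand : PolyF V →ₐ[ℝ] MvPolynomial (Fin S.k) (PolyF W) :=
  MvPolynomial.aeval fun L =>
    ∑ i, MvPolynomial.C (MvPolynomial.C (L (S.e i))) * MvPolynomial.X i +
      MvPolynomial.C (MvPolynomial.X (L ∘ₗ S.s))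

/-- The monomials in the coordinates of the kernel. -/
def mono (α : Fin S.k →₀ ℕ) : PolyF V := α.prod fun i n => MvPolynomial.X (S.x i) ^ n

theorem mono_mem_mId {α : Fin S.k →₀ ℕ} (hα : α ≠ 0) : S.mono α ∈ mId V := by
  rw [mem_mId_iff, mono, Finsupp.prod, map_prod]
  obtain ⟨i, hi⟩ := Finsupp.support_nonempty_iff.2 hα
  refine Finset.prod_eq_zero hi ?_
  rw [map_pow, MvPolynomial.constantCoeff_X, zero_pow (Finsupp.mem_support_iff.1 hi)]

theorem mono_zero : S.mono 0 = 1 := Finsupp.prod_zero_index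

theorem expand_pull (b : PolyF W) : S.expand (pull S.π b) = MvPolynomial.C b := by
  have h : S.expand.comp (pull S.π) =
      (IsScalarTower.toAlgHom ℝ (PolyF W) (MvPolynomial (Fin S.k) (PolyF W))) := by
    refine MvPolynomial.algHom_ext fun L => ?_
    have h1 : (L ∘ₗ S.π) ∘ₗ S.s = L := LinearMap.ext fun w => by simp [S.π_s]
    have h2 : ∀ i, S.π (S.e i) = 0 := fun i => S.π_eq_zero _ (S.e_mem i)
    simp [pull_X, expand, h1, h2, MvPolynomial.algebraMap_eq]
  exact DFunLike.congr_fun h b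

theorem coeff_zero_expand (a : PolyF V) : (S.expand a).coeff 0 = pull S.s a := by
  rw [← MvPolynomial.constantCoeff_eq]
  have h : (MvPolynomial.constantCoeff.comp S.expand.toRingHom : PolyF V →+* PolyF W) =
      (pull S.s).toRingHom := by
    refine MvPolynomial.ringHom_ext (fun r => ?_) fun L => ?_
    · simp [expand, pull, MvPolynomial.algebraMap_eq]
    · simp [pull_X, expand]
  exact DFunLike.congr_fun h a

theorem eval_expand (a : PolyF V) (c : Fin S.k → ℝ) (w : W) :
    MvPolynomial.eval₂ (polyEval W w) c (S.expand a) =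
      polyEval V (∑ i, c i • S.e i + S.s w) a := by
  have h : (MvPolynomial.eval₂Hom (polyEval W w) c).comp S.expand.toRingHom =
      polyEval V (∑ i, c i • S.e i + S.s w) := by
    refine MvPolynomial.ringHom_ext (fun r => ?_) fun L => ?_
    · simp [expand, polyEval]
    · simp [expand, polyEval, mul_comm]
  exact DFunLike.congr_fun h a

theorem eval_expand_coords (a : PolyF V) (v : V) :
    MvPolynomial.eval₂ (polyEval W (S.π v)) (fun i => S.x i v) (S.expand a) = polyEval V v a := by
  rw [S.eval_expand, ← S.decomp]

theorem sum_mono_expand (a : PolyF V) (T : Finset (Fin S.k →₀ ℕ)) (hT : (S.expand a).support ⊆ T)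
    (v : V) :
    polyEval V v (∑ α ∈ T, S.mono α * pull S.π ((S.expand a).coeff α)) = polyEval V v a := by
  rw [← S.eval_expand_coords a v, MvPolynomial.eval₂_eq, map_sum]
  symm
  refine Finset.sum_subset_zero_on_sdiff hT ?_ ?_
  · intro α hα
    rw [MvPolynomial.notMem_support_iff.1 (Finset.mem_sdiff.1 hα).2, map_zero, mul_zero, map_zero]
  · intro α _
    rw [map_mul, polyEval_pull, mul_comm, mono, Finsupp.prod, map_prod]
    congr 1
    refine Finset.prod_congr rfl fun i _ => ?_
    simp [polyEval]

theorem coeff_expand_mem_vanishingIdeal {τ : Set V} (hτ : σ ⊆ τ) {a : PolyF V}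
    (ha : a ∈ vanishingIdeal V τ) (α : Fin S.k →₀ ℕ) :
    (S.expand a).coeff α ∈ vanishingIdeal W (S.π '' τ) := by
  intro w hw
  have h : MvPolynomial.map (polyEval W w) (S.expand a) = 0 := by
    refine MvPolynomial.funext fun c => ?_
    rw [MvPolynomial.eval_map, S.eval_expand, map_zero]
    refine ha _ (Submodule.add_mem _ (Submodule.sum_mem _ fun i _ => Submodule.smul_mem _ _ ?_)
      (S.s_mem_span hτ hw))
    exact Submodule.span_mono hτ (S.e_mem i)
  have h2 := congrArg (MvPolynomial.coeff α) h
  rwa [MvPolynomial.coeff_map, MvPolynomial.coeff_zero] at h2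

theorem pull_mem_vanishingIdeal {τ : Set V} {b : PolyF W}
    (hb : b ∈ vanishingIdeal W (S.π '' τ)) : pull S.π b ∈ vanishingIdeal V τ := by
  intro v hv
  rw [polyEval_pull]
  exact hb _ (S.π_mem_span hv)

end ConeSplitting

end Polynomials

/-! ### Graded real vector spaces and modules over polynomial functions -/

section Graded

variable {M N : Type*} [AddCommGroup M] [Module ℝ M] [AddCommGroup N] [Module ℝ N]

theorem exists_graded_projection {D : ℕ → Submodule ℝ M} (hD : DirectSum.IsInternal D) :
    ∃ P : ℕ → M →ₗ[ℝ] M, (∀ n x, P n x ∈ D n) ∧ (∀ n, ∀ x ∈ D n, P n x = x) ∧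
      ∀ m n, ∀ x ∈ D m, m ≠ n → P n x = 0 := by
  let E : (DirectSum ℕ fun n => D n) ≃ₗ[ℝ] M :=
    LinearEquiv.ofBijective (DirectSum.coeLinearMap D) hD
  have hE : ∀ m (x : M) (hx : x ∈ D m), E.symm x = DirectSum.lof ℝ ℕ (fun n => D n) m ⟨x, hx⟩ := by
    intro m x hx
    rw [LinearEquiv.symm_apply_eq]
    exact (DirectSum.coeLinearMap_lof D m ⟨x, hx⟩).symm
  refine ⟨fun n => (D n).subtype ∘ₗ DirectSum.component ℝ ℕ (fun n => D n) n ∘ₗ E.symm.toLinearMap,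
    fun n x => Subtype.mem _, fun n x hx => ?_, fun m n x hx hmn => ?_⟩
  · simp [hE n x hx, DirectSum.component.lof_self]
  · simp [hE m x hx, DirectSum.component.of, hmn]

/-- A homogeneous element in the span of homogeneous elements is in the span of those of the same
degree. -/
theorem mem_span_of_mem_graded {D : ℕ → Submodule ℝ M} (hD : DirectSum.IsInternal D)
    {T : ℕ → Set M} (hT : ∀ n, T n ⊆ D n) {k : ℕ} {x : M} (hx : x ∈ D k)
    (hxT : x ∈ Submodule.span ℝ (⋃ n, T n)) : x ∈ Submodule.span ℝ (T k) := by
  obtain ⟨P, -, hP1, hP0⟩ := exists_graded_projection hD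
  have h : Submodule.span ℝ (⋃ n, T n) ≤ (Submodule.span ℝ (T k)).comap (P k) := by
    rw [Submodule.span_le]
    intro y hy
    obtain ⟨n, hn⟩ := Set.mem_iUnion.1 hy
    by_cases hnk : n = k
    · subst hnk
      simpa [hP1 n y (hT n hn)] using Submodule.subset_span hn
    · simp [hP0 n k y (hT n hn) hnk]
  have := h hxT
  rwa [Submodule.mem_comap, hP1 k x hx] at this

/-- A linear map that respects degrees commutes with the projections to graded pieces. -/
theorem graded_map_comm {D : ℕ → Submodule ℝ M} (hD : DirectSum.IsInternal D)
    {E : ℕ → Submodule ℝ N} {P : M →ₗ[ℝ] M} {Q : N →ₗ[ℝ] N} {n : ℕ}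
    (hP1 : ∀ x ∈ D n, P x = x) (hP0 : ∀ m, ∀ x ∈ D m, m ≠ n → P x = 0)
    (hQ1 : ∀ x ∈ E n, Q x = x) (hQ0 : ∀ m, ∀ x ∈ E m, m ≠ n → Q x = 0)
    {f : M →ₗ[ℝ] N} (hf : ∀ n, ∀ x ∈ D n, f x ∈ E n) (x : M) : f (P x) = Q (f x) := by
  have h : ⨆ n, D n ≤ LinearMap.eqLocus (f ∘ₗ P) (Q ∘ₗ f) := by
    refine iSup_le fun m y hy => ?_
    rw [LinearMap.mem_eqLocus, LinearMap.comp_apply, LinearMap.comp_apply]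
    by_cases hm : m = n
    · subst hm
      rw [hP1 y hy, hQ1 _ (hf m y hy)]
    · rw [hP0 m y hy hm, hQ0 m _ (hf m y hy) hm, map_zero]
  rw [hD.submodule_iSup_eq_top] at h
  exact h (Submodule.mem_top : x ∈ ⊤)

/-- A linear map killing the kernel of a surjection factors through it. -/
theorem exists_linearMap_comp_eq {K : Type*} [AddCommGroup K] [Module ℝ K] {q : K →ₗ[ℝ] M}
    (hq : Function.Surjective q) {g : K →ₗ[ℝ] N} (h : ∀ a, q a = 0 → g a = 0) :
    ∃ f : M →ₗ[ℝ] N, ∀ a, f (q a) = g a := by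
  refine ⟨(LinearMap.ker q).liftQ g h ∘ₗ (q.quotKerEquivOfSurjective hq).symm.toLinearMap,
    fun a => ?_⟩
  have h1 : (q.quotKerEquivOfSurjective hq).symm (q a) = Submodule.Quotient.mk a := by
    rw [LinearEquiv.symm_apply_eq]
    rfl
  rw [LinearMap.comp_apply, LinearEquiv.coe_coe, h1]
  exact Submodule.liftQ_apply _ _ _

end Graded

section Modules

variable {M : Type*} [AddCommGroup M] [Module ℝ M] (ρ : PolyF V →ₐ[ℝ] Module.End ℝ M)

/-- The vanishing ideal as an ideal. -/
def vIdeal (σ : Set V) : Ideal (PolyF V) where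
  carrier := vanishingIdeal V σ
  add_mem' ha hb x hx := by rw [map_add, ha x hx, hb x hx, add_zero]
  zero_mem' x _ := map_zero _
  smul_mem' c p hp x hx := by rw [smul_eq_mul, map_mul, hp x hx, mul_zero]

/-- A finite family `m` is a basis of a module over the quotient by the ideal `I`. -/
structure IsFreeBasis (I : Ideal (PolyF V)) {n : ℕ} (m : Fin n → M) : Prop where
  gen : ∀ x, ∃ a : Fin n → PolyF V, x = ∑ i, ρ (a i) (m i)
  rel : ∀ a : Fin n → PolyF V, ∑ i, ρ (a i) (m i) = 0 ↔ ∀ i, a i ∈ I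

/-- The action of polynomial functions is compatible with the grading. -/
def GradedAction (D : ℕ → Submodule ℝ M) : Prop :=
  ∀ (i n : ℕ) (p : PolyF V), p.IsHomogeneous i → ∀ x ∈ D n, ρ p x ∈ D (n + i)

/-- The product of the irrelevant ideal with a module. -/
def mMul : Submodule ℝ M := Submodule.span ℝ {y | ∃ p ∈ mId V, ∃ z, y = ρ p z}

variable {ρ}

theorem apply_mem_of_homogeneous {D : ℕ → Submodule ℝ M} (hD : DirectSum.IsInternal D)
    (Q : Submodule ℝ M) (p : PolyF V)
    (h : ∀ q l, ∀ z ∈ D l, ρ (MvPolynomial.homogeneousComponent q p) z ∈ Q) (z : M) :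
    ρ p z ∈ Q := by
  rw [← MvPolynomial.sum_homogeneousComponent p, map_sum, LinearMap.sum_apply]
  refine Submodule.sum_mem _ fun q _ => ?_
  have h1 : ⨆ n, D n ≤ Q.comap (ρ (MvPolynomial.homogeneousComponent q p)) :=
    iSup_le fun l z hz => h q l z hz
  rw [hD.submodule_iSup_eq_top] at h1
  exact h1 (Submodule.mem_top : z ∈ ⊤)

theorem mem_range_of_mem_span {n : ℕ} {m : Fin n → M} {x : M}
    (hx : x ∈ Submodule.span ℝ {y | ∃ p i, y = ρ p (m i)}) :
    ∃ a : Fin n → PolyF V, x = ∑ i, ρ (a i) (m i) := by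
  induction hx using Submodule.span_induction with
  | mem x hx =>
    obtain ⟨p, i, rfl⟩ := hx
    refine ⟨Pi.single i p, ?_⟩
    rw [Finset.sum_eq_single i]
    · simp
    · intro b _ hb; simp [hb]
    · simp
  | zero => exact ⟨0, by simp⟩
  | add x y _ _ hx hy =>
    obtain ⟨a, rfl⟩ := hx
    obtain ⟨b, rfl⟩ := hy
    exact ⟨a + b, by simp [Finset.sum_add_distrib]⟩
  | smul r x _ hx =>
    obtain ⟨a, rfl⟩ := hx
    exact ⟨r • a, by simp [Finset.smul_sum]⟩

theorem graded_nakayama {D : ℕ → Submodule ℝ M} (hD : DirectSum.IsInternal D)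
    (hρ : GradedAction ρ D) (Q : Submodule ℝ M) (hQ : ∀ p, ∀ x ∈ Q, ρ p x ∈ Q)
    {n : ℕ} {m : Fin n → M} {j : Fin n → ℕ} (hm : ∀ i, m i ∈ D (j i)) (hmQ : ∀ i, m i ∈ Q)
    (h : Submodule.span ℝ {y | ∃ p i, y = ρ p (m i)} ⊔ mMul ρ = ⊤) : Q = ⊤ := by
  let T : ℕ → Set M := fun k =>
    {y | ∃ i p q, MvPolynomial.IsHomogeneous p q ∧ k = j i + q ∧ y = ρ p (m i)} ∪
    {y | ∃ p q l, ∃ z ∈ D l, MvPolynomial.IsHomogeneous p q ∧ 0 < q ∧ k = l + q ∧ y = ρ p z}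
  have hT : ∀ k, T k ⊆ D k := by
    rintro k y (⟨i, p, q, hp, rfl, rfl⟩ | ⟨p, q, l, z, hz, hp, -, rfl, rfl⟩)
    · exact hρ _ _ _ hp _ (hm i)
    · exact hρ _ _ _ hp _ hz
  have htop : Submodule.span ℝ (⋃ k, T k) = ⊤ := by
    rw [← top_le_iff, ← h, sup_le_iff]
    constructor
    · rw [Submodule.span_le]
      rintro _ ⟨p, i, rfl⟩
      rw [← MvPolynomial.sum_homogeneousComponent p, map_sum, LinearMap.sum_apply]
      refine Submodule.sum_mem _ fun q _ => Submodule.subset_span (Set.mem_iUnion.2 ⟨j i + q, ?_⟩)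
      exact Or.inl ⟨i, _, q, MvPolynomial.homogeneousComponent_isHomogeneous q p, rfl, rfl⟩
    · rw [mMul, Submodule.span_le]
      rintro _ ⟨p, hp, z, rfl⟩
      refine apply_mem_of_homogeneous hD _ p (fun q l z hz => ?_) z
      rcases Nat.eq_zero_or_pos q with rfl | hq
      · rw [mem_mId_iff, MvPolynomial.constantCoeff_eq] at hp
        rw [MvPolynomial.homogeneousComponent_zero, hp]
        simp
      · exact Submodule.subset_span (Set.mem_iUnion.2 ⟨l + q, Or.inr ⟨_, q, l, z, hz,
          MvPolynomial.homogeneousComponent_isHomogeneous q p, hq, rfl, rfl⟩⟩)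
  have key : ∀ k, D k ≤ Q := by
    intro k
    induction k using Nat.strong_induction_on with
    | _ k ih =>
      intro x hx
      have h1 := mem_span_of_mem_graded hD hT hx (htop ▸ Submodule.mem_top)
      refine (Submodule.span_le.2 ?_) h1
      rintro y (⟨i, p, q, hp, -, rfl⟩ | ⟨p, q, l, z, hz, hp, hq, rfl, rfl⟩)
      · exact hQ _ _ (hmQ i)
      · exact hQ _ _ (ih l (by omega) hz)
  rw [← top_le_iff, ← hD.submodule_iSup_eq_top]
  exact iSup_le key

theorem mMul_coeffs {n : ℕ} {m : Fin n → M}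
    (hgen : ∀ x, ∃ a : Fin n → PolyF V, x = ∑ i, ρ (a i) (m i)) {x : M} (hx : x ∈ mMul ρ) :
    ∃ a : Fin n → PolyF V, (∀ i, a i ∈ mId V) ∧ x = ∑ i, ρ (a i) (m i) := by
  rw [mMul] at hx
  induction hx using Submodule.span_induction with
  | mem x hx =>
    obtain ⟨p, hp, z, rfl⟩ := hx
    obtain ⟨a, rfl⟩ := hgen z
    exact ⟨fun i => p * a i, fun i => Ideal.mul_mem_right _ _ hp, by simp⟩
  | zero => exact ⟨0, fun i => Ideal.zero_mem _, by simp⟩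
  | add x y _ _ hx hy =>
    obtain ⟨a, ha, rfl⟩ := hx
    obtain ⟨b, hb, rfl⟩ := hy
    exact ⟨a + b, fun i => Ideal.add_mem _ (ha i) (hb i), by simp [Finset.sum_add_distrib]⟩
  | smul r x _ hx =>
    obtain ⟨a, ha, rfl⟩ := hx
    refine ⟨r • a, fun i => ?_, by simp [Finset.smul_sum]⟩
    rw [Pi.smul_apply, MvPolynomial.smul_eq_C_mul]
    exact Ideal.mul_mem_left _ _ (ha i)

theorem IsFreeBasis.eq_zero_of_mem_mMul {σ : Set V} {n : ℕ} {m : Fin n → M}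
    (hm : IsFreeBasis ρ (vIdeal σ) m) {r : Fin n → ℝ} (hr : ∑ i, r i • m i ∈ mMul ρ) : r = 0 := by
  obtain ⟨a, ha, h⟩ := mMul_coeffs hm.gen hr
  have h1 : ∑ i, ρ (algebraMap ℝ _ (r i) - a i) (m i) = 0 := by
    simp only [map_sub, LinearMap.sub_apply, Finset.sum_sub_distrib, AlgHom.commutes,
      Module.algebraMap_end_apply, h, sub_self]
  funext i
  have h2 := constantCoeff_eq_zero_of_mem_vanishingIdeal ((hm.rel _).1 h1 i)
  rw [map_sub, (mem_mId_iff _).1 (ha i), sub_zero, MvPolynomial.algebraMap_eq,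
    MvPolynomial.constantCoeff_C] at h2
  exact h2

theorem card_le_of_eq_zero_of_mem_mMul {n N : ℕ} {m : Fin n → M} {μ : Fin N → M}
    (hμ : ∀ x, ∃ a : Fin N → PolyF V, x = ∑ i, ρ (a i) (μ i))
    (hm : ∀ r : Fin n → ℝ, ∑ i, r i • m i ∈ mMul ρ → r = 0) : n ≤ N := by
  choose P hP using fun i => hμ (m i)
  let v : Fin n → Fin N → ℝ := fun i j => MvPolynomial.constantCoeff (P i j)
  have hv : LinearIndependent ℝ v := by
    rw [Fintype.linearIndependent_iff]
    intro r hr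
    refine congrFun (hm r ?_)
    have h1 : ∑ i, r i • m i = ∑ j, ρ (∑ i, r i • P i j) (μ j) := by
      simp only [map_sum, map_smul, LinearMap.sum_apply, LinearMap.smul_apply]
      rw [Finset.sum_comm]
      refine Finset.sum_congr rfl fun i _ => ?_
      rw [← Finset.smul_sum, ← hP]
    rw [h1]
    refine Submodule.sum_mem _ fun j _ => Submodule.subset_span ⟨_, ?_, _, rfl⟩
    rw [mem_mId_iff]
    simpa [v, MvPolynomial.smul_eq_C_mul] using congrFun hr j
  simpa using hv.fintype_card_le_finrank

theorem IsFreeBasis.of_gen {I : Ideal (PolyF V)} {n N : ℕ} {μ : Fin N → M}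
    (hμ : IsFreeBasis ρ I μ) {m : Fin n → M} (hnN : n ≤ N)
    (hm : ∀ x, ∃ a : Fin n → PolyF V, x = ∑ i, ρ (a i) (m i)) : IsFreeBasis ρ I m := by
  refine ⟨hm, ?_⟩
  have hann : ∀ p ∈ I, ∀ x, ρ p x = 0 := by
    intro p hp x
    obtain ⟨a, rfl⟩ := hμ.gen x
    have := (hμ.rel fun i => p * a i).2 fun i => Ideal.mul_mem_right _ _ hp
    simpa using this
  let : Module (PolyF V) M := Module.compHom M ρ.toRingHom
  have : Module.Finite (PolyF V) M := by
    refine ⟨⟨Finset.univ.image μ, ?_⟩⟩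
    rw [← top_le_iff]
    intro x _
    obtain ⟨a, rfl⟩ := hμ.gen x
    exact Submodule.sum_mem _ fun i _ => Submodule.smul_mem _ (a i)
      (Submodule.subset_span (by simp))
  let φ : (Fin n → M) → (Fin n → PolyF V ⧸ I) →ₗ[PolyF V] M := fun m =>
    ∑ i, (Submodule.liftQ I (LinearMap.toSpanSingleton (PolyF V) M (m i))
      (fun p hp => hann p hp _)) ∘ₗ LinearMap.proj i
  have hφ : ∀ m (a : Fin n → PolyF V),
      φ m (fun i => Submodule.Quotient.mk (a i)) = ∑ i, ρ (a i) (m i) := by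
    intro m a
    simp only [φ, LinearMap.sum_apply, LinearMap.comp_apply, LinearMap.proj_apply]
    rfl
  have hlift : ∀ b : Fin n → PolyF V ⧸ I, ∃ a : Fin n → PolyF V,
      b = fun i => Submodule.Quotient.mk (a i) := by
    intro b
    choose a ha using fun i => Submodule.Quotient.mk_surjective I (b i)
    exact ⟨a, funext fun i => (ha i).symm⟩
  have hinj : Function.Injective (φ fun i => μ (Fin.castLE hnN i)) := by
    rw [injective_iff_map_eq_zero]
    intro b hb
    obtain ⟨a, rfl⟩ := hlift b
    rw [hφ] at hb
    have hι := Fin.castLE_injective hnN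
    have h1 : ∑ j, ρ (Function.extend (Fin.castLE hnN) a 0 j) (μ j) = 0 := by
      rw [← hb]
      symm
      refine Fintype.sum_of_injective _ hι _ _ (fun j hj => ?_) fun i => ?_
      · rw [Function.extend_apply' _ _ _ hj]; simp
      · rw [hι.extend_apply]
    funext i
    have h2 := (hμ.rel _).1 h1 (Fin.castLE hnN i)
    rw [hι.extend_apply] at h2
    exact (Submodule.Quotient.mk_eq_zero I).2 h2
  have hsurj : Function.Surjective (φ m) := fun x => by
    obtain ⟨a, rfl⟩ := hm x
    exact ⟨_, hφ m a⟩
  have hinj' := OrzechProperty.injective_of_surjective_of_injective _ _ hinj hsurj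
  intro a
  constructor
  · intro h i
    rw [← hφ] at h
    exact (Submodule.Quotient.mk_eq_zero I).1 (congrFun (hinj' (h.trans (map_zero _).symm)) i)
  · intro h
    exact Finset.sum_eq_zero fun i _ => hann _ (h i) _

end Modules

/-! ### Comparison of modules over polynomial functions on `V` and on `W` -/

section Comparison

variable {W : Type} [AddCommGroup W] [Module ℝ W] {σ : Set V} (S : ConeSplitting σ W)
variable {M M₁ : Type} [AddCommGroup M] [Module ℝ M] [AddCommGroup M₁] [Module ℝ M₁]
variable (ρ : PolyF V →ₐ[ℝ] Module.End ℝ M) (ρ₁ : PolyF W →ₐ[ℝ] Module.End ℝ M₁)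

/-- The map `ψ` exhibits `M` as the extension of scalars of `M₁` along `π`; this is witnessed by
the maps that extract the coefficients with respect to the coordinates of the kernel. -/
structure IsExtension (ψ : M₁ →ₗ[ℝ] M) : Prop where
  map_act : ∀ b y, ψ (ρ₁ b y) = ρ (pull S.π b) (ψ y)
  exists_coeff : ∃ c : M →ₗ[ℝ] ((Fin S.k →₀ ℕ) → M₁),
    ∀ a y α, c (ρ a (ψ y)) α = ρ₁ ((S.expand a).coeff α) y
  span_eq_top : Submodule.span ℝ {z | ∃ a y, z = ρ a (ψ y)} = ⊤

variable {ρ ρ₁ S}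

/-- A module map matching two bases is an extension of scalars. -/
theorem exists_isExtension {τ : Set V} (hτ : σ ⊆ τ) {n : ℕ} {m' : Fin n → M₁} {m : Fin n → M}
    (h' : IsFreeBasis ρ₁ (vIdeal (S.π '' τ)) m') (h : IsFreeBasis ρ (vIdeal τ) m) :
    ∃ ψ : M₁ →ₗ[ℝ] M, IsExtension S ρ ρ₁ ψ ∧
      ∀ b : Fin n → PolyF W, ψ (∑ i, ρ₁ (b i) (m' i)) = ∑ i, ρ (pull S.π (b i)) (m i) := by
  let q' : (Fin n → PolyF W) →ₗ[ℝ] M₁ := ∑ i, (ρ₁.toLinearMap.flip (m' i)) ∘ₗ LinearMap.proj i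
  let q : (Fin n → PolyF V) →ₗ[ℝ] M := ∑ i, (ρ.toLinearMap.flip (m i)) ∘ₗ LinearMap.proj i
  let g : (Fin n → PolyF W) →ₗ[ℝ] M :=
    ∑ i, (ρ.toLinearMap.flip (m i)) ∘ₗ (pull S.π).toLinearMap ∘ₗ LinearMap.proj i
  let gc : (Fin n → PolyF V) →ₗ[ℝ] ((Fin S.k →₀ ℕ) → M₁) := LinearMap.pi fun α =>
    ∑ i, (ρ₁.toLinearMap.flip (m' i)) ∘ₗ (MvPolynomial.lcoeff (PolyF W) α).restrictScalars ℝ ∘ₗ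
      S.expand.toLinearMap ∘ₗ LinearMap.proj i
  have hq' : ∀ b, q' b = ∑ i, ρ₁ (b i) (m' i) := fun b => by simp [q', LinearMap.sum_apply]
  have hq : ∀ b, q b = ∑ i, ρ (b i) (m i) := fun b => by simp [q, LinearMap.sum_apply]
  have hg : ∀ b, g b = ∑ i, ρ (pull S.π (b i)) (m i) := fun b => by simp [g, LinearMap.sum_apply]
  have hgc : ∀ a α, gc a α = ∑ i, ρ₁ ((S.expand (a i)).coeff α) (m' i) := fun a α => by
    simp [gc, LinearMap.sum_apply]
  obtain ⟨ψ, hψ⟩ := exists_linearMap_comp_eq (q := q') (g := g)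
    (fun y => by obtain ⟨b, rfl⟩ := h'.gen y; exact ⟨b, hq' b⟩) fun b hb => by
      rw [hq', h'.rel] at hb
      rw [hg, h.rel]
      exact fun i => S.pull_mem_vanishingIdeal (hb i)
  obtain ⟨c, hc⟩ := exists_linearMap_comp_eq (q := q) (g := gc)
    (fun y => by obtain ⟨b, rfl⟩ := h.gen y; exact ⟨b, hq b⟩) fun b hb => by
      rw [hq, h.rel] at hb
      funext α
      rw [hgc, Pi.zero_apply, h'.rel]
      exact fun i => S.coeff_expand_mem_vanishingIdeal hτ (hb i) α
  simp only [hq', hg] at hψ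
  have hc' : ∀ (a : Fin n → PolyF V) α,
      c (∑ i, ρ (a i) (m i)) α = ∑ i, ρ₁ ((S.expand (a i)).coeff α) (m' i) := fun a α => by
    rw [← hq, hc, hgc]
  refine ⟨ψ, ⟨?_, ⟨c, ?_⟩, ?_⟩, hψ⟩
  · intro b y
    obtain ⟨a, rfl⟩ := h'.gen y
    have := hψ fun i => b * a i
    simpa [hψ] using this
  · intro a y α
    obtain ⟨b, rfl⟩ := h'.gen y
    have e : ∀ i, (S.expand (a * pull S.π (b i))).coeff α = (S.expand a).coeff α * b i := by
      intro i
      rw [map_mul, S.expand_pull, mul_comm, MvPolynomial.coeff_C_mul, mul_comm]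
    have h1 := hc' (fun i => a * pull S.π (b i)) α
    simp only [e] at h1
    simpa [hψ] using h1
  · rw [← top_le_iff]
    intro x _
    obtain ⟨a, rfl⟩ := h.gen x
    refine Submodule.sum_mem _ fun i _ => Submodule.subset_span ⟨a i, m' i, ?_⟩
    have := hψ (Pi.single i 1)
    rw [Finset.sum_eq_single i (fun j _ hj => by simp [hj]) (by simp),
      Finset.sum_eq_single i (fun j _ hj => by simp [hj]) (by simp)] at this
    have h1 : ψ (m' i) = m i := by simpa using this
    rw [h1]

theorem map_mem_of_graded_basis {n : ℕ} {m' : Fin n → M₁} {m : Fin n → M} {j : Fin n → ℕ}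
    {D : ℕ → Submodule ℝ M} {D' : ℕ → Submodule ℝ M₁} (hD' : DirectSum.IsInternal D')
    (hρ : GradedAction ρ D) (hρ₁ : GradedAction ρ₁ D') (hm : ∀ i, m i ∈ D (j i))
    (hm' : ∀ i, m' i ∈ D' (j i)) (hgen : ∀ x, ∃ a : Fin n → PolyF W, x = ∑ i, ρ₁ (a i) (m' i))
    {ψ : M₁ →ₗ[ℝ] M}
    (hψ : ∀ b : Fin n → PolyF W, ψ (∑ i, ρ₁ (b i) (m' i)) = ∑ i, ρ (pull S.π (b i)) (m i))
    {k : ℕ} {y : M₁} (hy : y ∈ D' k) : ψ y ∈ D k := by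
  let T : ℕ → Set M₁ := fun k =>
    {y | ∃ i p q, MvPolynomial.IsHomogeneous p q ∧ k = j i + q ∧ y = ρ₁ p (m' i)}
  have hT : ∀ k, T k ⊆ D' k := by
    rintro k y ⟨i, p, q, hp, rfl, rfl⟩
    exact hρ₁ _ _ _ hp _ (hm' i)
  have h1 := mem_span_of_mem_graded hD' hT hy (by
    obtain ⟨a, rfl⟩ := hgen y
    refine Submodule.sum_mem _ fun i _ => ?_
    rw [← MvPolynomial.sum_homogeneousComponent (a i), map_sum, LinearMap.sum_apply]
    refine Submodule.sum_mem _ fun q _ => Submodule.subset_span (Set.mem_iUnion.2 ⟨j i + q, ?_⟩)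
    exact ⟨i, _, q, MvPolynomial.homogeneousComponent_isHomogeneous q _, rfl, rfl⟩)
  have h2 : Submodule.span ℝ (T k) ≤ (D k).comap ψ := by
    rw [Submodule.span_le]
    rintro y ⟨i, p, q, hp, rfl, rfl⟩
    have := hψ (Pi.single i p)
    rw [Finset.sum_eq_single i (fun j _ hj => by simp [hj]) (by simp),
      Finset.sum_eq_single i (fun j _ hj => by simp [hj]) (by simp)] at this
    simp only [Pi.single_eq_same] at this
    rw [SetLike.mem_coe, Submodule.mem_comap, this]
    exact hρ _ _ _ (pull_isHomogeneous _ hp) _ (hm i)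
  exact h2 h1

namespace IsExtension

variable {ψ : M₁ →ₗ[ℝ] M} (h : IsExtension S ρ ρ₁ ψ)

/-- The maps extracting the coefficients with respect to the coordinates of the kernel. -/
def coeff : M →ₗ[ℝ] ((Fin S.k →₀ ℕ) → M₁) := h.exists_coeff.choose

theorem coeff_act (a : PolyF V) (y : M₁) (α : Fin S.k →₀ ℕ) :
    h.coeff (ρ a (ψ y)) α = ρ₁ ((S.expand a).coeff α) y :=
  h.exists_coeff.choose_spec a y α

theorem ext (h : IsExtension S ρ ρ₁ ψ) {N : Type} [AddCommGroup N] [Module ℝ N] {f g : M →ₗ[ℝ] N}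
    (hfg : ∀ a y, f (ρ a (ψ y)) = g (ρ a (ψ y))) (x : M) : f x = g x := by
  have h1 : Submodule.span ℝ {z | ∃ a y, z = ρ a (ψ y)} ≤ LinearMap.eqLocus f g := by
    rw [Submodule.span_le]
    rintro _ ⟨a, y, rfl⟩
    exact hfg a y
  rw [h.span_eq_top] at h1
  exact h1 (Submodule.mem_top : x ∈ ⊤)

theorem coeff_zero_apply (y : M₁) : h.coeff (ψ y) 0 = y := by
  have := h.coeff_act 1 y 0
  simpa [S.coeff_zero_expand] using this

theorem coeff_zero_act (p : PolyF V) (x : M) :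
    h.coeff (ρ p x) 0 = ρ₁ (pull S.s p) (h.coeff x 0) := by
  refine h.ext (f := LinearMap.proj 0 ∘ₗ h.coeff ∘ₗ ρ p)
    (g := ρ₁ (pull S.s p) ∘ₗ LinearMap.proj 0 ∘ₗ h.coeff) (fun a y => ?_) x
  have h1 : ρ p (ρ a (ψ y)) = ρ (p * a) (ψ y) := by simp
  simp only [LinearMap.comp_apply, LinearMap.proj_apply]
  rw [h1, h.coeff_act, h.coeff_act, S.coeff_zero_expand, S.coeff_zero_expand]
  simp

/-- Every element is recovered from its coefficients. -/
theorem exists_finset_sum (hann : ∀ p ∈ vIdeal (Set.univ : Set V), ∀ x, ρ p x = 0) (x : M) :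
    ∃ T : Finset (Fin S.k →₀ ℕ), ∀ T', T ⊆ T' →
      x = ∑ α ∈ T', ρ (S.mono α) (ψ (h.coeff x α)) := by
  have hx : x ∈ Submodule.span ℝ {z | ∃ a y, z = ρ a (ψ y)} := h.span_eq_top ▸ Submodule.mem_top
  induction hx using Submodule.span_induction with
  | mem x hx =>
    obtain ⟨a, y, rfl⟩ := hx
    refine ⟨(S.expand a).support, fun T' hT' => ?_⟩
    have h1 : ρ (∑ α ∈ T', S.mono α * pull S.π ((S.expand a).coeff α) - a) (ψ y) = 0 := by
      refine hann _ (fun v _ => ?_) _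
      rw [map_sub, S.sum_mono_expand a T' hT' v, sub_self]
    rw [map_sub, LinearMap.sub_apply, sub_eq_zero] at h1
    have h2 : ∀ α, ρ (S.mono α) (ψ (h.coeff (ρ a (ψ y)) α)) =
        ρ (S.mono α * pull S.π ((S.expand a).coeff α)) (ψ y) := fun α => by
      rw [h.coeff_act, h.map_act, map_mul]
      rfl
    rw [Finset.sum_congr rfl fun α _ => h2 α, ← h1, map_sum, LinearMap.sum_apply]
  | zero => exact ⟨∅, fun T' _ => by simp⟩
  | add x y _ _ hx hy =>
    obtain ⟨T₁, h₁⟩ := hx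
    obtain ⟨T₂, h₂⟩ := hy
    refine ⟨T₁ ∪ T₂, fun T' hT' => ?_⟩
    conv_lhs => rw [h₁ T' (Finset.union_subset_left hT'), h₂ T' (Finset.union_subset_right hT')]
    simp [Finset.sum_add_distrib]
  | smul r x _ hx =>
    obtain ⟨T, hT⟩ := hx
    refine ⟨T, fun T' hT' => ?_⟩
    conv_lhs => rw [hT T' hT']
    simp [Finset.smul_sum]

theorem coeff_zero_mem {D : ℕ → Submodule ℝ M} {D' : ℕ → Submodule ℝ M₁}
    (hD : DirectSum.IsInternal D) (hD' : DirectSum.IsInternal D')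
    (hρ : GradedAction ρ D) (hρ₁ : GradedAction ρ₁ D')
    (hψ : ∀ n, ∀ y ∈ D' n, ψ y ∈ D n) {k : ℕ} {x : M} (hx : x ∈ D k) :
    h.coeff x 0 ∈ D' k := by
  let T : ℕ → Set M := fun k =>
    {z | ∃ a q l, ∃ y ∈ D' l, MvPolynomial.IsHomogeneous a q ∧ k = l + q ∧ z = ρ a (ψ y)}
  have hT : ∀ k, T k ⊆ D k := by
    rintro k _ ⟨a, q, l, y, hy, ha, rfl, rfl⟩
    exact hρ _ _ _ ha _ (hψ _ _ hy)
  have htop : Submodule.span ℝ (⋃ k, T k) = ⊤ := by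
    rw [← top_le_iff, ← h.span_eq_top, Submodule.span_le]
    rintro _ ⟨a, y, rfl⟩
    have h1 : ⨆ n, D' n ≤ (Submodule.span ℝ (⋃ k, T k)).comap (ρ a ∘ₗ ψ) := by
      refine iSup_le fun l y hy => ?_
      rw [Submodule.mem_comap, ← MvPolynomial.sum_homogeneousComponent a, map_sum,
        LinearMap.comp_apply, LinearMap.sum_apply]
      refine Submodule.sum_mem _ fun q _ => Submodule.subset_span (Set.mem_iUnion.2 ⟨l + q, ?_⟩)
      exact ⟨_, q, l, y, hy, MvPolynomial.homogeneousComponent_isHomogeneous q _, rfl, rfl⟩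
    rw [hD'.submodule_iSup_eq_top] at h1
    exact h1 (Submodule.mem_top : y ∈ ⊤)
  have h1 := mem_span_of_mem_graded hD hT hx (htop ▸ Submodule.mem_top)
  have h2 : Submodule.span ℝ (T k) ≤ (D' k).comap (LinearMap.proj 0 ∘ₗ h.coeff) := by
    rw [Submodule.span_le]
    rintro _ ⟨a, q, l, y, hy, ha, rfl, rfl⟩
    rw [SetLike.mem_coe, Submodule.mem_comap, LinearMap.comp_apply, LinearMap.proj_apply,
      h.coeff_act, S.coeff_zero_expand]
    exact hρ₁ _ _ _ (pull_isHomogeneous _ ha) _ hy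
  exact h2 h1

end IsExtension

end Comparison

/-! ### Sheaves -/

section Sheaves

variable {F : SheafData V} {Δ : Fan V}

/-- The action of polynomial functions on a stalk. -/
def IsSheafOn.act (hF : IsSheafOn F Δ) {τ : Set V} (hτ : τ ∈ Δ.cones) :
    PolyF V →ₐ[ℝ] Module.End ℝ (F.stalk τ) where
  toFun p :=
    { toFun := F.asmul τ p
      map_add' := hF.asmul_dist τ hτ p
      map_smul' := fun r x => by
        rw [RingHom.id_apply, ← hF.asmul_const τ hτ, ← hF.asmul_const τ hτ r (F.asmul τ p x),
          ← hF.asmul_mul τ hτ, ← hF.asmul_mul τ hτ, mul_comm] }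
  map_one' := LinearMap.ext fun x => hF.asmul_one τ hτ x
  map_mul' p q := LinearMap.ext fun x => hF.asmul_mul τ hτ p q x
  map_zero' := LinearMap.ext fun x => by
    have := hF.asmul_const τ hτ 0 x
    rwa [map_zero, zero_smul] at this
  map_add' p q := LinearMap.ext fun x => hF.asmul_add τ hτ p q x
  commutes' r := LinearMap.ext fun x => hF.asmul_const τ hτ r x

theorem IsSheafOn.gradedAction (hF : IsSheafOn F Δ) {τ : Set V} (hτ : τ ∈ Δ.cones) :
    GradedAction (hF.act hτ) (F.deg τ) := fun i n p hp x hx => hF.deg_asmul τ hτ i n p hp x hx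

theorem IsSheafOn.act_eq_zero (hF : IsSheafOn F Δ) {τ : Set V} (hτ : τ ∈ Δ.cones)
    (p : PolyF V) (hp : p ∈ vIdeal (Set.univ : Set V)) (x : F.stalk τ) : hF.act hτ p x = 0 :=
  hF.annih τ hτ p (fun v _ => hp v (Submodule.subset_span (Set.mem_univ v))) x

theorem IsPureOn.exists_basis (hF : IsPureOn F Δ) {τ : Set V} (hτ : τ ∈ Δ.cones) :
    ∃ (n : ℕ) (m : Fin n → F.stalk τ) (j : Fin n → ℕ), (∀ i, m i ∈ F.deg τ (j i)) ∧
      IsFreeBasis (hF.1.act hτ) (vIdeal τ) m := by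
  obtain ⟨n, m, j, h1, h2, h3⟩ := hF.2.2 τ hτ
  exact ⟨n, m, j, h1, h2, h3⟩

/-- Sections are closed under multiplication by polynomial functions. -/
def IsSheafOn.smulSec (hF : IsSheafOn F Δ) {T : Set (Set V)} (hT : T ⊆ Δ.cones) (p : PolyF V)
    (z : secs F T) : secs F T :=
  ⟨fun γ => F.asmul γ.1 p (z.1 γ), fun τ γ h => by
    rw [hF.res_asmul τ.1 (hT τ.2) γ.1 h, z.2 τ γ h]⟩

theorem IsSheafOn.smulSec_mem (hF : IsSheafOn F Δ) {T : Set (Set V)} (hT : T ⊆ Δ.cones)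
    {p : PolyF V} (hp : p ∈ mId V) (z : secs F T) : hF.smulSec hT p z ∈ mSecs F T :=
  Submodule.subset_span ⟨p, hp, z, rfl⟩

/-- Transport of stalks along an equality of cones. -/
def SheafData.castStalk (F : SheafData V) {a b : Set V} (h : a = b) : F.stalk a →ₗ[ℝ] F.stalk b :=
  h ▸ LinearMap.id

theorem IsSimple.stalk_eq_zero [FiniteDimensional ℝ V] {σ : Set V} (hF : IsSimple F Δ σ)
    {τ : Set V} (hτ : τ ∈ Δ.cones) (h : τ ∉ Δ.star σ) (x : F.stalk τ) : x = 0 := by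
  induction hn : coneDim V τ using Nat.strong_induction_on generalizing τ with
  | _ n ih =>
    by_cases hdim : coneDim V τ ≤ coneDim V σ
    · refine hF.2.2.1 τ hτ hdim ?_ x
      rintro rfl
      exact h ⟨hτ, IsFaceOf.refl _⟩
    · have hbij := hF.2.2.2 τ hτ (not_le.1 hdim)
      have hall : ∀ z : F.stalk τ, z ∈ mMul (hF.1.1.act hτ) := by
        intro z
        refine hbij.2 z ?_
        have : resFam F τ z = 0 := by
          funext γ
          have hγ := γ.2
          exact ih _ (hn ▸ hγ.1.coneDim_lt hγ.2) (Δ.faceClosed _ hτ _ hγ.1)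
            (fun hs => h (Δ.mem_star_of_isFaceOf hs hτ hγ.1)) _ rfl
        rw [this]
        exact Submodule.zero_mem _
      obtain ⟨k, m, j, -, hm⟩ := hF.1.exists_basis hτ
      have hk : (fun _ => (1 : ℝ) : Fin k → ℝ) = 0 := hm.eq_zero_of_mem_mMul (hall _)
      rcases k with _ | k
      · obtain ⟨a, rfl⟩ := hm.gen x
        simp
      · exact absurd (congrFun hk 0) one_ne_zero

end Sheaves

/-! ### The simple sheaf and the minimal extension sheaf of the link -/

section Link

variable {W : Type} [AddCommGroup W] [Module ℝ W] {σ : Set V}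

/-- The fan `Λ` is the link of `σ` in `Δ`, with simple sheaves on `Δ` based at `σ` and on `Λ`
based at the image of `σ`. -/
structure LinkSetup (Δ : Fan V) (F : SheafData V) (S : ConeSplitting σ W) (Λ : Fan W)
    (F' : SheafData W) : Prop where
  mem : σ ∈ Δ.cones
  cones_eq : Λ.cones = (fun τ => S.π '' τ) '' Δ.star σ
  simple : IsSimple F Δ σ
  simple_link : IsSimple F' Λ (S.π '' σ)

namespace LinkSetup

variable {Δ : Fan V} {F : SheafData V} {S : ConeSplitting σ W} {Λ : Fan W} {F' : SheafData W}

theorem image_mem (L : LinkSetup Δ F S Λ F') {τ : Set V} (hτ : τ ∈ Δ.star σ) :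
    S.π '' τ ∈ Λ.cones := by
  rw [L.cones_eq]
  exact ⟨τ, hτ, rfl⟩

theorem isSheaf (L : LinkSetup Δ F S Λ F') : IsSheafOn F Δ := L.simple.1.1

theorem isSheaf' (L : LinkSetup Δ F S Λ F') : IsSheafOn F' Λ := L.simple_link.1.1

/-- A family of stalk maps on the cones of `T` which are extensions of scalars, compatible with
gradings and with restriction maps. -/
structure IsComparison (L : LinkSetup Δ F S Λ F') (T : Set (Set V))
    (ψ : ∀ τ : Set V, F'.stalk (S.π '' τ) →ₗ[ℝ] F.stalk τ) : Prop where
  ext : ∀ τ (hτ : τ ∈ Δ.star σ), τ ∈ T →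
    IsExtension S (L.isSheaf.act hτ.1) (L.isSheaf'.act (L.image_mem hτ)) (ψ τ)
  deg : ∀ τ ∈ Δ.star σ, τ ∈ T → ∀ n, ∀ y ∈ F'.deg (S.π '' τ) n, ψ τ y ∈ F.deg τ n
  nat : ∀ τ ∈ Δ.star σ, τ ∈ T → ∀ γ ∈ Δ.star σ, γ ∈ T → IsFaceOf V γ τ → ∀ y,
    F.res τ γ (ψ τ y) = ψ γ (F'.res (S.π '' τ) (S.π '' γ) y)

namespace IsComparison

variable {L : LinkSetup Δ F S Λ F'} {T : Set (Set V)}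
  {ψ : ∀ τ : Set V, F'.stalk (S.π '' τ) →ₗ[ℝ] F.stalk τ}

theorem coeff_nat (h : L.IsComparison T ψ) {τ γ : Set V} (hτ : τ ∈ Δ.star σ) (hτT : τ ∈ T)
    (hγ : γ ∈ Δ.star σ) (hγT : γ ∈ T) (hf : IsFaceOf V γ τ) (α : Fin S.k →₀ ℕ) (x : F.stalk τ) :
    F'.res (S.π '' τ) (S.π '' γ) ((h.ext τ hτ hτT).coeff x α) =
      (h.ext γ hγ hγT).coeff (F.res τ γ x) α := by
  refine (h.ext τ hτ hτT).ext
    (f := F'.res (S.π '' τ) (S.π '' γ) ∘ₗ LinearMap.proj α ∘ₗ (h.ext τ hτ hτT).coeff)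
    (g := LinearMap.proj α ∘ₗ (h.ext γ hγ hγT).coeff ∘ₗ F.res τ γ) (fun a y => ?_) x
  have h1 := (h.ext τ hτ hτT).coeff_act a y α
  have h2 := (h.ext γ hγ hγT).coeff_act a (F'.res (S.π '' τ) (S.π '' γ) y) α
  have h3 : F.res τ γ (L.isSheaf.act hτ.1 a (ψ τ y)) =
      L.isSheaf.act hγ.1 a (ψ γ (F'.res (S.π '' τ) (S.π '' γ) y)) := by
    rw [← h.nat τ hτ hτT γ hγ hγT hf]
    exact L.isSheaf.res_asmul τ hτ.1 γ hf a _
  simp only [LinearMap.comp_apply, LinearMap.proj_apply]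
  rw [h1, h3, h2]
  exact L.isSheaf'.res_asmul _ (L.image_mem hτ) _ (S.isFaceOf_image hf hγ.2.subset) _ y

variable {T' : Set (Set W)}

theorem exists_secs_map [FiniteDimensional ℝ V] (h : L.IsComparison T ψ) (hT : T ⊆ Δ.cones)
    (hT' : T' = (fun τ => S.π '' τ) '' (T ∩ Δ.star σ)) :
    ∃ Ψ : secs F' T' →ₗ[ℝ] secs F T, ∀ g γ (hγ : γ ∈ T) (_ : γ ∈ Δ.star σ)
      (hγ' : S.π '' γ ∈ T'), (Ψ g).1 ⟨γ, hγ⟩ = ψ γ (g.1 ⟨S.π '' γ, hγ'⟩) := by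
  have hmem : ∀ γ ∈ T, γ ∈ Δ.star σ → S.π '' γ ∈ T' := fun γ h1 h2 => by
    rw [hT']
    exact ⟨γ, ⟨h1, h2⟩, rfl⟩
  let u : (secs F' T') →ₗ[ℝ] (∀ γ : T, F.stalk γ.1) := LinearMap.pi fun γ =>
    if hγ : γ.1 ∈ Δ.star σ then
      ψ γ.1 ∘ₗ LinearMap.proj (⟨S.π '' γ.1, hmem γ.1 γ.2 hγ⟩ : T') ∘ₗ (secs F' T').subtype
    else 0
  have hu : ∀ g γ (hγ : γ ∈ T) (_ : γ ∈ Δ.star σ) (hγ' : S.π '' γ ∈ T'),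
      u g ⟨γ, hγ⟩ = ψ γ (g.1 ⟨S.π '' γ, hγ'⟩) := by
    intro g γ hγ hs hγ'
    simp [u, hs]
  refine ⟨u.codRestrict (secs F T) ?_, hu⟩
  rintro g ⟨τ, hτ⟩ ⟨γ, hγ⟩ hf
  by_cases hs : γ ∈ Δ.star σ
  · have hτs : τ ∈ Δ.star σ := Δ.mem_star_of_isFaceOf hs (hT hτ) hf
    rw [hu g τ hτ hτs (hmem _ hτ hτs), hu g γ hγ hs (hmem _ hγ hs)]
    refine (h.nat τ hτs hτ γ hs hγ hf _).trans ?_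
    have h3 : ∀ a b : T', IsFaceOf W b.1 a.1 → F'.res a.1 b.1 (g.1 a) = g.1 b := g.2
    rw [h3 ⟨S.π '' τ, hmem _ hτ hτs⟩ ⟨S.π '' γ, hmem _ hγ hs⟩ (S.isFaceOf_image hf hs.2.subset)]
  · rw [L.simple.stalk_eq_zero (hT hγ) hs (u g ⟨γ, hγ⟩)]
    exact L.simple.stalk_eq_zero (hT hγ) hs _

theorem exists_secs_coeff (h : L.IsComparison T ψ)
    (hT' : T' = (fun τ => S.π '' τ) '' (T ∩ Δ.star σ)) (α : Fin S.k →₀ ℕ) :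
    ∃ E : secs F T →ₗ[ℝ] secs F' T', ∀ f γ (hγ : γ ∈ T) (hs : γ ∈ Δ.star σ)
      (hγ' : S.π '' γ ∈ T'), (E f).1 ⟨S.π '' γ, hγ'⟩ = (h.ext γ hs hγ).coeff (f.1 ⟨γ, hγ⟩) α := by
  have hlift : ∀ y : T', ∃ γ, ∃ (_ : γ ∈ T) (_ : γ ∈ Δ.star σ), S.π '' γ = y.1 := by
    rintro ⟨y, hy⟩
    rw [hT'] at hy
    obtain ⟨γ, hγ, rfl⟩ := hy
    exact ⟨γ, hγ.1, hγ.2, rfl⟩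
  choose r hrT hrs hr using hlift
  let u : (secs F T) →ₗ[ℝ] (∀ y : T', F'.stalk y.1) := LinearMap.pi fun y =>
    F'.castStalk (hr y) ∘ₗ LinearMap.proj α ∘ₗ (h.ext (r y) (hrs y) (hrT y)).coeff ∘ₗ
      LinearMap.proj (⟨r y, hrT y⟩ : T) ∘ₗ (secs F T).subtype
  have hu : ∀ f γ (hγ : γ ∈ T) (hs : γ ∈ Δ.star σ) (hγ' : S.π '' γ ∈ T'),
      u f ⟨S.π '' γ, hγ'⟩ = (h.ext γ hs hγ).coeff (f.1 ⟨γ, hγ⟩) α := by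
    intro f γ hγ hs hγ'
    have h1 : r ⟨_, hγ'⟩ = γ := S.image_injOn (hrs _) hs (hr ⟨_, hγ'⟩)
    have h2 : ∀ γ₀ (e : γ₀ = γ) (hT₀ : γ₀ ∈ T) (hs₀ : γ₀ ∈ Δ.star σ) (he : S.π '' γ₀ = S.π '' γ),
        F'.castStalk he ((h.ext γ₀ hs₀ hT₀).coeff (f.1 ⟨γ₀, hT₀⟩) α) =
          (h.ext γ hs hγ).coeff (f.1 ⟨γ, hγ⟩) α := by
      rintro γ₀ rfl hT₀ hs₀ he
      rfl
    exact h2 _ h1 (hrT _) (hrs _) (hr ⟨_, hγ'⟩)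
  refine ⟨u.codRestrict (secs F' T') ?_, hu⟩
  rintro f ⟨τ', hτ'⟩ ⟨γ', hγ'⟩ hf
  have hτ'' := hτ'
  have hγ'' := hγ'
  rw [hT'] at hτ'' hγ''
  obtain ⟨τ, ⟨hτT, hτs⟩, rfl⟩ := hτ''
  obtain ⟨γ, ⟨hγT, hγs⟩, rfl⟩ := hγ''
  have hface := S.isFaceOf_of_image hγs hτs hf
  rw [hu f τ hτT hτs hτ', hu f γ hγT hγs hγ']
  refine (h.coeff_nat hτs hτT hγs hγT hface α _).trans ?_
  have h3 : ∀ a b : T, IsFaceOf V b.1 a.1 → F.res a.1 b.1 (f.1 a) = f.1 b := f.2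
  rw [h3 ⟨τ, hτT⟩ ⟨γ, hγT⟩ hface]

/-- A comparison induces an isomorphism of graded vector spaces on the reductions of the modules
of sections. -/
theorem secs_comparison [FiniteDimensional ℝ V] (h : L.IsComparison T ψ) (hT : T ⊆ Δ.cones)
    (hT' : T' = (fun τ => S.π '' τ) '' (T ∩ Δ.star σ)) :
    ∃ Ψ : secs F' T' →ₗ[ℝ] secs F T,
      (∀ g γ (hγ : γ ∈ T) (_ : γ ∈ Δ.star σ) (hγ' : S.π '' γ ∈ T'),
        (Ψ g).1 ⟨γ, hγ⟩ = ψ γ (g.1 ⟨S.π '' γ, hγ'⟩)) ∧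
      (∀ g, Ψ g ∈ mSecs F T ↔ g ∈ mSecs F' T') ∧
      (∀ n, ∀ g ∈ degSec F' T' n, Ψ g ∈ degSec F T n) ∧
      ∀ f, ∃ g, f - Ψ g ∈ mSecs F T ∧ ∀ n, f ∈ degSec F T n → g ∈ degSec F' T' n := by
  obtain ⟨Ψ, hΨ⟩ := h.exists_secs_map hT hT'
  choose E hE using h.exists_secs_coeff hT'
  have hmem : ∀ γ ∈ T, γ ∈ Δ.star σ → S.π '' γ ∈ T' := fun γ h1 h2 => by
    rw [hT']
    exact ⟨γ, ⟨h1, h2⟩, rfl⟩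
  have hT'Λ : T' ⊆ Λ.cones := by
    rw [hT', L.cones_eq]
    exact Set.image_mono Set.inter_subset_right
  have hext : ∀ f f' : secs F T, (∀ γ (hγ : γ ∈ T) (_ : γ ∈ Δ.star σ),
      f.1 ⟨γ, hγ⟩ = f'.1 ⟨γ, hγ⟩) → f = f' := by
    intro f f' hff
    refine Subtype.ext (funext fun ⟨γ, hγ⟩ => ?_)
    by_cases hs : γ ∈ Δ.star σ
    · exact hff γ hγ hs
    · rw [L.simple.stalk_eq_zero (hT hγ) hs (f.1 ⟨γ, hγ⟩)]
      exact (L.simple.stalk_eq_zero (hT hγ) hs _).symm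
  have hext' : ∀ g g' : secs F' T', (∀ γ (_ : γ ∈ T) (_ : γ ∈ Δ.star σ) (hγ' : S.π '' γ ∈ T'),
      g.1 ⟨S.π '' γ, hγ'⟩ = g'.1 ⟨S.π '' γ, hγ'⟩) → g = g' := by
    intro g g' hgg
    refine Subtype.ext (funext fun ⟨γ', hγ'⟩ => ?_)
    have hγ'' := hγ'
    rw [hT'] at hγ''
    obtain ⟨γ, hγ, rfl⟩ := hγ''
    exact hgg γ hγ.1 hγ.2 hγ'
  have hEΨ : ∀ g, E 0 (Ψ g) = g := fun g => hext' _ _ fun γ hγ hs hγ' => by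
    rw [hE 0 _ γ hγ hs hγ', hΨ g γ hγ hs hγ', (h.ext γ hs hγ).coeff_zero_apply]
  have hΨm : mSecs F' T' ≤ (mSecs F T).comap Ψ := by
    refine Submodule.span_le.2 ?_
    rintro g ⟨p, hp, z, hz⟩
    have h1 : Ψ g = L.isSheaf.smulSec hT (pull S.π p) (Ψ z) := hext _ _ fun γ hγ hs => by
      rw [hΨ g γ hγ hs (hmem γ hγ hs), hz]
      refine ((h.ext γ hs hγ).map_act p _).trans ?_
      rw [← hΨ z γ hγ hs (hmem γ hγ hs)]
      rfl
    rw [SetLike.mem_coe, Submodule.mem_comap, h1]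
    exact L.isSheaf.smulSec_mem hT (pull_mem_mId _ hp) _
  have hEm : mSecs F T ≤ (mSecs F' T').comap (E 0) := by
    refine Submodule.span_le.2 ?_
    rintro f ⟨p, hp, z, hz⟩
    have h1 : E 0 f = L.isSheaf'.smulSec hT'Λ (pull S.s p) (E 0 z) :=
      hext' _ _ fun γ hγ hs hγ' => by
        rw [hE 0 f γ hγ hs hγ', hz]
        refine ((h.ext γ hs hγ).coeff_zero_act p _).trans ?_
        rw [← hE 0 z γ hγ hs hγ']
        rfl
    rw [SetLike.mem_coe, Submodule.mem_comap, h1]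
    exact L.isSheaf'.smulSec_mem hT'Λ (pull_mem_mId _ hp) _
  refine ⟨Ψ, hΨ, fun g => ⟨fun hg => ?_, fun hg => hΨm hg⟩, ?_, fun f => ⟨E 0 f, ?_, ?_⟩⟩
  · have := hEm hg
    rwa [Submodule.mem_comap, hEΨ] at this
  · intro n g hg
    rintro ⟨γ, hγ⟩ -
    by_cases hs : γ ∈ Δ.star σ
    · have := h.deg γ hs hγ n _ (hg ⟨S.π '' γ, hmem γ hγ hs⟩ (Set.mem_univ _))
      change (Ψ g).1 ⟨γ, hγ⟩ ∈ F.deg γ n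
      rw [hΨ g γ hγ hs (hmem γ hγ hs)]
      exact this
    · have h0 : (secs F T).subtype (Ψ g) ⟨γ, hγ⟩ = 0 := L.simple.stalk_eq_zero (hT hγ) hs _
      rw [h0]
      exact Submodule.zero_mem _
  · have : Finite T := Δ.finite.subset hT
    have hfin : ∀ γ : T, ∃ R : Finset (Fin S.k →₀ ℕ), ∀ R', R ⊆ R' → ∀ hs : γ.1 ∈ Δ.star σ,
        f.1 γ = ∑ α ∈ R', L.isSheaf.act hs.1 (S.mono α)
          (ψ γ.1 ((h.ext γ.1 hs γ.2).coeff (f.1 γ) α)) := by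
      intro γ
      by_cases hs : γ.1 ∈ Δ.star σ
      · obtain ⟨R, hR⟩ := (h.ext γ.1 hs γ.2).exists_finset_sum (L.isSheaf.act_eq_zero hs.1) (f.1 γ)
        exact ⟨R, fun R' hR' _ => hR R' hR'⟩
      · exact ⟨∅, fun _ _ hs' => absurd hs' hs⟩
    choose R hR using hfin
    have := Fintype.ofFinite T
    let Q : Finset (Fin S.k →₀ ℕ) := insert 0 (Finset.univ.biUnion R)
    have hQ : ∀ γ, R γ ⊆ Q := fun γ =>
      (Finset.subset_biUnion_of_mem R (Finset.mem_univ γ)).trans (Finset.subset_insert _ _)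
    have hsum : f = ∑ α ∈ Q, L.isSheaf.smulSec hT (S.mono α) (Ψ (E α f)) := by
      refine hext _ _ fun γ hγ hs => ?_
      rw [hR ⟨γ, hγ⟩ Q (hQ _) hs]
      rw [AddSubmonoidClass.coe_finsetSum, Finset.sum_apply]
      refine Finset.sum_congr rfl fun α _ => ?_
      rw [← hE α f γ hγ hs (hmem γ hγ hs), ← hΨ _ γ hγ hs (hmem γ hγ hs)]
      rfl
    have h0 : L.isSheaf.smulSec hT (S.mono 0) (Ψ (E 0 f)) = Ψ (E 0 f) := by
      refine Subtype.ext (funext fun γ => ?_)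
      change F.asmul γ.1 (S.mono 0) _ = _
      rw [S.mono_zero, L.isSheaf.asmul_one _ (hT γ.2)]
    have h1 : f - Ψ (E 0 f) = ∑ α ∈ Q.erase 0, L.isSheaf.smulSec hT (S.mono α) (Ψ (E α f)) := by
      rw [← Finset.add_sum_erase Q _ (Finset.mem_insert_self 0 _), h0] at hsum
      exact sub_eq_iff_eq_add'.2 hsum
    rw [h1]
    exact Submodule.sum_mem _ fun α hα =>
      L.isSheaf.smulSec_mem hT (S.mono_mem_mId (Finset.ne_of_mem_erase hα)) _
  · intro n hf
    rintro ⟨γ', hγ'⟩ -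
    have hγ'' := hγ'
    rw [hT'] at hγ''
    obtain ⟨γ, ⟨hγ, hs⟩, rfl⟩ := hγ''
    have hf' : ∀ a : T, f.1 a ∈ F.deg a.1 n := fun a => hf a (Set.mem_univ _)
    have := (h.ext γ hs hγ).coeff_zero_mem (L.isSheaf.deg_internal γ hs.1)
      (L.isSheaf'.deg_internal _ (L.image_mem hs)) (L.isSheaf.gradedAction hs.1)
      (L.isSheaf'.gradedAction (L.image_mem hs)) (h.deg γ hs hγ) (hf' ⟨γ, hγ⟩)
    change (E 0 f).1 ⟨S.π '' γ, hγ'⟩ ∈ F'.deg (S.π '' γ) n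
    rw [hE 0 f γ hγ hs hγ']
    exact this

end IsComparison

end LinkSetup

end Link

/-! ### Sections over the boundary of a cone -/

section Boundary

variable {F : SheafData V} {Δ : Fan V}

/-- The restriction of a stalk to the boundary of the cone, as a map to sections. -/
def IsSheafOn.toBdry (hF : IsSheafOn F Δ) {τ : Set V} (hτ : τ ∈ Δ.cones) :
    F.stalk τ →ₗ[ℝ] secs F (properFaces V τ) :=
  (resFam F τ).codRestrict (secs F (properFaces V τ)) fun x γ δ h =>
    hF.res_comp τ hτ γ.1 δ.1 γ.2.1 h x

theorem properFaces_subset (Δ : Fan V) {τ : Set V} (hτ : τ ∈ Δ.cones) :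
    properFaces V τ ⊆ Δ.cones := fun γ hγ => Δ.faceClosed τ hτ γ hγ.1

theorem subfan_properFaces (Δ : Fan V) {τ : Set V} (hτ : τ ∈ Δ.cones) :
    Subfan V Δ (properFaces V τ) := by
  refine ⟨properFaces_subset Δ hτ, fun γ hγ δ hδ => ⟨Δ.isFaceOf_trans hτ hδ hγ.1, ?_⟩⟩
  rintro rfl
  exact hγ.2 (Set.Subset.antisymm hγ.1.subset hδ.subset)

theorem IsSheafOn.toBdry_mem_mSecs (hF : IsSheafOn F Δ) {τ : Set V} (hτ : τ ∈ Δ.cones)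
    {x : F.stalk τ} (hx : x ∈ mMul (hF.act hτ)) :
    hF.toBdry hτ x ∈ mSecs F (properFaces V τ) := by
  have h : mMul (hF.act hτ) ≤ (mSecs F (properFaces V τ)).comap (hF.toBdry hτ) := by
    refine Submodule.span_le.2 ?_
    rintro _ ⟨p, hp, z, rfl⟩
    have h1 : hF.toBdry hτ (hF.act hτ p z) =
        hF.smulSec (properFaces_subset Δ hτ) p (hF.toBdry hτ z) :=
      Subtype.ext (funext fun γ => hF.res_asmul τ hτ γ.1 γ.2.1 p z)
    rw [SetLike.mem_coe, Submodule.mem_comap, h1]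
    exact hF.smulSec_mem _ hp _
  exact h hx

theorem IsSheafOn.mem_mBdry_iff (hF : IsSheafOn F Δ) {τ : Set V} (hτ : τ ∈ Δ.cones)
    (x : F.stalk τ) :
    resFam F τ x ∈ mBdry F τ ↔ hF.toBdry hτ x ∈ mSecs F (properFaces V τ) := by
  constructor
  · rintro ⟨f, hf, hfx⟩
    have : hF.toBdry hτ x = f := Subtype.ext hfx.symm
    rwa [this]
  · intro h
    exact ⟨_, h, rfl⟩

theorem BarResBij.exists_toBdry_sub_mem (hF : IsSheafOn F Δ) {τ : Set V} (hτ : τ ∈ Δ.cones)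
    (h : BarResBij F τ) (f : secs F (properFaces V τ)) :
    ∃ x, hF.toBdry hτ x - f ∈ mSecs F (properFaces V τ) := by
  obtain ⟨x, m, ⟨g, hg, rfl⟩, hx⟩ := h.1 f.1 f.2
  refine ⟨x, ?_⟩
  have : hF.toBdry hτ x - f = g :=
    Subtype.ext (funext fun γ => sub_eq_iff_eq_add'.2 (hx γ))
  rwa [this]

theorem BarResBij.mem_mMul (hF : IsSheafOn F Δ) {τ : Set V} (hτ : τ ∈ Δ.cones)
    (h : BarResBij F τ) {x : F.stalk τ} (hx : hF.toBdry hτ x ∈ mSecs F (properFaces V τ)) :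
    x ∈ mMul (hF.act hτ) :=
  h.2 x ((hF.mem_mBdry_iff hτ x).2 hx)

/-- Homogeneous sections over the boundary of a cone lift to homogeneous elements. -/
theorem IsPureOn.exists_toBdry_eq (hF : IsPureOn F Δ) {τ : Set V}
    (hτ : τ ∈ Δ.cones) {n : ℕ} {f : secs F (properFaces V τ)}
    (hf : f ∈ degSec F (properFaces V τ) n) :
    ∃ x ∈ F.deg τ n, hF.1.toBdry hτ x = f := by
  obtain ⟨g, hg, hgf⟩ := hF.2.1 Δ.cones (properFaces V τ) ⟨subset_rfl, fun σ hσ τ h =>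
    Δ.faceClosed σ hσ τ h⟩ (subfan_properFaces Δ hτ) (properFaces_subset Δ hτ) f.1 f.2
  obtain ⟨P, hP, hP1, hP0⟩ := exists_graded_projection (hF.1.deg_internal τ hτ)
  have hg' : ∀ a b : Δ.cones, IsFaceOf V b.1 a.1 → F.res a.1 b.1 (g a) = g b := hg
  refine ⟨P n (g ⟨τ, hτ⟩), hP n _, Subtype.ext (funext fun γ => ?_)⟩
  have hγ := properFaces_subset Δ hτ γ.2
  obtain ⟨Q, -, hQ1, hQ0⟩ := exists_graded_projection (hF.1.deg_internal γ.1 hγ)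
  change F.res τ γ.1 (P n (g ⟨τ, hτ⟩)) = f.1 γ
  rw [graded_map_comm (hF.1.deg_internal τ hτ) (hP1 n) (fun m => hP0 m n) (hQ1 n)
    (fun m => hQ0 m n) (hF.1.res_deg τ hτ γ.1 γ.2.1), hg' ⟨τ, hτ⟩ ⟨γ.1, hγ⟩ γ.2.1]
  have h1 : g ⟨γ.1, hγ⟩ = f.1 γ := hgf γ
  rw [h1]
  exact hQ1 n _ (hf γ (Set.mem_univ _))

end Boundary


section Link

variable {W : Type} [AddCommGroup W] [Module ℝ W] {σ : Set V}
variable {Δ : Fan V} {F : SheafData V} {S : ConeSplitting σ W} {Λ : Fan W} {F' : SheafData W}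

namespace LinkSetup

theorem properFaces_image (S : ConeSplitting σ W) {τ : Set V} (hτ : τ ∈ Δ.star σ) :
    properFaces W (S.π '' τ) = (fun γ => S.π '' γ) '' (properFaces V τ ∩ Δ.star σ) := by
  ext γ'
  constructor
  · rintro ⟨hf, hne⟩
    obtain ⟨γ, h1, h2, rfl⟩ := S.exists_face_of_isFaceOf_image hτ.2 hf
    refine ⟨γ, ⟨⟨h1, ?_⟩, Δ.faceClosed τ hτ.1 γ h1, h2⟩, rfl⟩
    rintro rfl
    exact hne rfl
  · rintro ⟨γ, ⟨h1, h2⟩, rfl⟩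
    exact ⟨S.isFaceOf_image h1.1 h2.2.subset, fun h => h1.2 (S.image_injOn h2 hτ h)⟩

/-- A comparison over the boundary of a cone extends to the cone. -/
theorem IsComparison.exists_extend [FiniteDimensional ℝ V] [FiniteDimensional ℝ W]
    {L : LinkSetup Δ F S Λ F'} {τ : Set V} (hτ : τ ∈ Δ.star σ) (hne : τ ≠ σ)
    {ψ : ∀ τ : Set V, F'.stalk (S.π '' τ) →ₗ[ℝ] F.stalk τ}
    (h : L.IsComparison (properFaces V τ) ψ) :
    ∃ φ : F'.stalk (S.π '' τ) →ₗ[ℝ] F.stalk τ,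
      IsExtension S (L.isSheaf.act hτ.1) (L.isSheaf'.act (L.image_mem hτ)) φ ∧
      (∀ n, ∀ y ∈ F'.deg (S.π '' τ) n, φ y ∈ F.deg τ n) ∧
      ∀ γ ∈ Δ.star σ, γ ∈ properFaces V τ → ∀ y,
        F.res τ γ (φ y) = ψ γ (F'.res (S.π '' τ) (S.π '' γ) y) := by
  have hτ' := L.image_mem hτ
  have hσ : σ ∈ Δ.star σ := ⟨L.mem, IsFaceOf.refl σ⟩
  have hbij : BarResBij F τ := L.simple.2.2.2 τ hτ.1 (hτ.2.coneDim_lt hne.symm)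
  have hbij' : BarResBij F' (S.π '' τ) := L.simple_link.2.2.2 _ hτ'
    ((S.isFaceOf_image hτ.2 subset_rfl).coneDim_lt fun e => hne (S.image_injOn hσ hτ e).symm)
  obtain ⟨Ψ, hΨ, hΨm, hΨd, hΨs⟩ :=
    h.secs_comparison (properFaces_subset Δ hτ.1) (properFaces_image S hτ)
  obtain ⟨n, m', j, hm'd, hm'⟩ := L.simple_link.1.exists_basis hτ'
  obtain ⟨N, μ, -, -, hμ⟩ := L.simple.1.exists_basis hτ.1
  have hlift : ∀ i, ∃ x ∈ F.deg τ (j i),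
      L.isSheaf.toBdry hτ.1 x = Ψ (L.isSheaf'.toBdry hτ' (m' i)) := fun i =>
    L.simple.1.exists_toBdry_eq hτ.1 <| hΨd _ _ fun γ _ =>
      L.isSheaf'.res_deg _ hτ' _ γ.2.1 _ _ (hm'd i)
  choose m hmd hm using hlift
  have hnat : ∀ b : Fin n → PolyF W, ∀ γ ∈ Δ.star σ, γ ∈ properFaces V τ →
      F.res τ γ (∑ i, L.isSheaf.act hτ.1 (pull S.π (b i)) (m i)) =
        ψ γ (F'.res (S.π '' τ) (S.π '' γ) (∑ i, L.isSheaf'.act hτ' (b i) (m' i))) := by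
    intro b γ hγs hγ
    rw [map_sum, map_sum, map_sum]
    refine Finset.sum_congr rfl fun i _ => ?_
    have hγ' : S.π '' γ ∈ properFaces W (S.π '' τ) := by
      rw [properFaces_image S hτ]
      exact ⟨γ, ⟨hγ, hγs⟩, rfl⟩
    have h1 : F.res τ γ (m i) = ψ γ (F'.res (S.π '' τ) (S.π '' γ) (m' i)) := by
      refine Eq.trans ?_ (hΨ (L.isSheaf'.toBdry hτ' (m' i)) γ hγ hγs hγ')
      rw [← hm]
      rfl
    have h2 : F.res τ γ (L.isSheaf.act hτ.1 (pull S.π (b i)) (m i)) =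
        L.isSheaf.act hγs.1 (pull S.π (b i)) (F.res τ γ (m i)) :=
      L.isSheaf.res_asmul τ hτ.1 γ hγ.1 _ _
    have h3 : F'.res (S.π '' τ) (S.π '' γ) (L.isSheaf'.act hτ' (b i) (m' i)) =
        L.isSheaf'.act (L.image_mem hγs) (b i) (F'.res (S.π '' τ) (S.π '' γ) (m' i)) :=
      L.isSheaf'.res_asmul _ hτ' _ hγ'.1 _ _
    rw [h2, h3, h1, (h.ext γ hγs hγ).map_act]
  have hB : ∀ b : Fin n → PolyF W,
      L.isSheaf.toBdry hτ.1 (∑ i, L.isSheaf.act hτ.1 (pull S.π (b i)) (m i)) =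
        Ψ (L.isSheaf'.toBdry hτ' (∑ i, L.isSheaf'.act hτ' (b i) (m' i))) := by
    refine fun b => Subtype.ext (funext fun ⟨γ, hγ⟩ => ?_)
    by_cases hγs : γ ∈ Δ.star σ
    · have hγ' : S.π '' γ ∈ properFaces W (S.π '' τ) := by
        rw [properFaces_image S hτ]
        exact ⟨γ, ⟨hγ, hγs⟩, rfl⟩
      rw [hΨ _ γ hγ hγs hγ']
      exact hnat b γ hγs hγ
    · have h0 := L.simple.stalk_eq_zero (properFaces_subset Δ hτ.1 hγ) hγs
      exact (h0 _).trans (h0 _).symm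
  have hgen : ∀ x, ∃ a : Fin n → PolyF V, x = ∑ i, L.isSheaf.act hτ.1 (a i) (m i) := by
    have htop : Submodule.span ℝ {y | ∃ p i, y = L.isSheaf.act hτ.1 p (m i)} = ⊤ := by
      refine graded_nakayama (L.isSheaf.deg_internal τ hτ.1) (L.isSheaf.gradedAction hτ.1) _ ?_
        hmd ?_ ?_
      · intro p x hx
        obtain ⟨a, rfl⟩ := mem_range_of_mem_span hx
        rw [map_sum]
        refine Submodule.sum_mem _ fun i _ => Submodule.subset_span ⟨p * a i, i, ?_⟩
        rw [map_mul]
        rfl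
      · exact fun i => Submodule.subset_span ⟨1, i, by simp⟩
      · rw [← top_le_iff]
        intro x _
        obtain ⟨g, hg, -⟩ := hΨs (L.isSheaf.toBdry hτ.1 x)
        obtain ⟨y, hy⟩ := hbij'.exists_toBdry_sub_mem L.isSheaf' hτ' g
        obtain ⟨b, rfl⟩ := hm'.gen y
        rw [← hΨm, map_sub, ← hB] at hy
        have h1 := hbij.mem_mMul L.isSheaf hτ.1
          (x := x - ∑ i, L.isSheaf.act hτ.1 (pull S.π (b i)) (m i)) (by
            rw [map_sub]
            have := Submodule.sub_mem _ hg hy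
            rwa [sub_sub_sub_cancel_right] at this)
        rw [← sub_add_cancel x (∑ i, L.isSheaf.act hτ.1 (pull S.π (b i)) (m i))]
        refine Submodule.add_mem _ (Submodule.mem_sup_right h1) (Submodule.mem_sup_left ?_)
        exact Submodule.sum_mem _ fun i _ => Submodule.subset_span ⟨_, i, rfl⟩
    exact fun x => mem_range_of_mem_span (htop ▸ Submodule.mem_top)
  have hcard : n ≤ N := by
    refine card_le_of_eq_zero_of_mem_mMul (m := m) hμ.gen fun r hr => ?_
    have h1 := L.isSheaf.toBdry_mem_mSecs hτ.1 hr
    have h2 := hB fun i => MvPolynomial.C (r i)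
    have e1 : ∀ i, L.isSheaf.act hτ.1 (pull S.π (MvPolynomial.C (r i))) (m i) = r i • m i := by
      intro i
      rw [← MvPolynomial.algebraMap_eq, AlgHom.commutes, AlgHom.commutes,
        Module.algebraMap_end_apply]
    have e2 : ∀ i, L.isSheaf'.act hτ' (MvPolynomial.C (r i)) (m' i) = r i • m' i := by
      intro i
      rw [← MvPolynomial.algebraMap_eq, AlgHom.commutes, Module.algebraMap_end_apply]
    simp only [e1, e2] at h2
    rw [h2, hΨm] at h1
    exact hm'.eq_zero_of_mem_mMul (hbij'.mem_mMul L.isSheaf' hτ' h1)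
  obtain ⟨φ, hφ, hφb⟩ := exists_isExtension hτ.2.subset hm' (hμ.of_gen hcard hgen)
  refine ⟨φ, hφ, fun k y hy => ?_, fun γ hγs hγ y => ?_⟩
  · exact map_mem_of_graded_basis (L.isSheaf'.deg_internal _ hτ') (L.isSheaf.gradedAction hτ.1)
      (L.isSheaf'.gradedAction hτ') hmd hm'd hm'.gen hφb hy
  · obtain ⟨b, rfl⟩ := hm'.gen y
    rw [hφb]
    exact hnat b γ hγs hγ

/-- The stalks at the base cones are matched by an extension of scalars. -/
theorem exists_isExtension_base (L : LinkSetup Δ F S Λ F') (hσ : σ ∈ Δ.star σ) :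
    ∃ φ : F'.stalk (S.π '' σ) →ₗ[ℝ] F.stalk σ,
      IsExtension S (L.isSheaf.act hσ.1) (L.isSheaf'.act (L.image_mem hσ)) φ ∧
      ∀ n, ∀ y ∈ F'.deg (S.π '' σ) n, φ y ∈ F.deg σ n := by
  obtain ⟨m, hmd, hmg, hmr⟩ := L.simple.2.1
  obtain ⟨m', hmd', hmg', hmr'⟩ := L.simple_link.2.1
  have hb : IsFreeBasis (L.isSheaf.act hσ.1) (vIdeal σ) (fun _ : Fin 1 => m) := by
    refine ⟨fun x => ?_, fun a => ?_⟩
    · obtain ⟨a, ha⟩ := hmg x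
      exact ⟨fun _ => a, by rw [Fin.sum_univ_one]; exact ha⟩
    · rw [Fin.sum_univ_one, Fin.forall_fin_one]
      exact hmr (a 0)
  have hb' : IsFreeBasis (L.isSheaf'.act (L.image_mem hσ)) (vIdeal (S.π '' σ))
      (fun _ : Fin 1 => m') := by
    refine ⟨fun x => ?_, fun a => ?_⟩
    · obtain ⟨a, ha⟩ := hmg' x
      exact ⟨fun _ => a, by rw [Fin.sum_univ_one]; exact ha⟩
    · rw [Fin.sum_univ_one, Fin.forall_fin_one]
      exact hmr' (a 0)
  obtain ⟨φ, hφ, hφb⟩ := exists_isExtension subset_rfl hb' hb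
  exact ⟨φ, hφ, fun k y hy => map_mem_of_graded_basis (j := fun _ => 0)
    (L.isSheaf'.deg_internal _ (L.image_mem hσ)) (L.isSheaf.gradedAction hσ.1)
    (L.isSheaf'.gradedAction (L.image_mem hσ)) (fun _ => hmd) (fun _ => hmd') hb'.gen hφb hy⟩

theorem IsComparison.mono {L : LinkSetup Δ F S Λ F'} {T U : Set (Set V)}
    {ψ : ∀ τ : Set V, F'.stalk (S.π '' τ) →ₗ[ℝ] F.stalk τ} (h : L.IsComparison T ψ) (hU : U ⊆ T) :
    L.IsComparison U ψ :=
  ⟨fun τ hτ hτU => h.ext τ hτ (hU hτU), fun τ hτ hτU => h.deg τ hτ (hU hτU),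
    fun τ hτ hτU γ hγ hγU => h.nat τ hτ (hU hτU) γ hγ (hU hγU)⟩

theorem exists_isComparison_coneDim_lt [FiniteDimensional ℝ V] [FiniteDimensional ℝ W]
    (L : LinkSetup Δ F S Λ F') (n : ℕ) :
    ∃ ψ, L.IsComparison {τ | coneDim V τ < n} ψ := by
  induction n with
  | zero =>
    exact ⟨fun _ => 0, fun _ _ h => absurd h (Nat.not_lt_zero _),
      fun _ _ h => absurd h (Nat.not_lt_zero _), fun _ _ h => absurd h (Nat.not_lt_zero _)⟩
  | succ n ih =>
    obtain ⟨ψ, hψ⟩ := ih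
    have hstep : ∀ τ, ∃ φ : F'.stalk (S.π '' τ) →ₗ[ℝ] F.stalk τ,
        ∀ (hτ : τ ∈ Δ.star σ), coneDim V τ = n →
          IsExtension S (L.isSheaf.act hτ.1) (L.isSheaf'.act (L.image_mem hτ)) φ ∧
          (∀ n, ∀ y ∈ F'.deg (S.π '' τ) n, φ y ∈ F.deg τ n) ∧
          ∀ γ ∈ Δ.star σ, γ ∈ properFaces V τ → ∀ y,
            F.res τ γ (φ y) = ψ γ (F'.res (S.π '' τ) (S.π '' γ) y) := by
      intro τ
      by_cases hτ : τ ∈ Δ.star σ ∧ coneDim V τ = n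
      · by_cases hne : τ = σ
        · subst hne
          obtain ⟨φ, h1, h2⟩ := L.exists_isExtension_base hτ.1
          refine ⟨φ, fun _ _ => ⟨h1, h2, fun γ hγs hγ => ?_⟩⟩
          exact absurd (Set.Subset.antisymm hγ.1.subset hγs.2.subset) hγ.2
        · obtain ⟨φ, hφ⟩ := IsComparison.exists_extend hτ.1 hne
            (hψ.mono fun γ hγ => (hγ.1.coneDim_lt hγ.2).trans_eq hτ.2)
          exact ⟨φ, fun _ _ => hφ⟩
      · exact ⟨0, fun h1 h2 => absurd ⟨h1, h2⟩ hτ⟩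
    choose φ hφ using hstep
    let χ : ∀ τ : Set V, F'.stalk (S.π '' τ) →ₗ[ℝ] F.stalk τ := fun τ =>
      if coneDim V τ = n then φ τ else ψ τ
    have h1 : ∀ τ, coneDim V τ = n → χ τ = φ τ := fun τ h => if_pos h
    have h2 : ∀ τ, coneDim V τ ≠ n → χ τ = ψ τ := fun τ h => if_neg h
    have hlt : ∀ {τ}, coneDim V τ < n + 1 → coneDim V τ ≠ n → coneDim V τ < n :=
      fun h h' => lt_of_le_of_ne (Nat.lt_succ_iff.1 h) h'
    refine ⟨χ, fun τ hτ hτn => ?_, fun τ hτ hτn => ?_, fun τ hτ hτn γ hγ hγn hf y => ?_⟩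
    · by_cases h : coneDim V τ = n
      · rw [h1 τ h]
        exact (hφ τ hτ h).1
      · rw [h2 τ h]
        exact hψ.ext τ hτ (hlt hτn h)
    · by_cases h : coneDim V τ = n
      · rw [h1 τ h]
        exact (hφ τ hτ h).2.1
      · rw [h2 τ h]
        exact hψ.deg τ hτ (hlt hτn h)
    · by_cases hne : γ = τ
      · subst hne
        rw [L.isSheaf.res_self γ hγ.1, L.isSheaf'.res_self _ (L.image_mem hγ)]
      · have h3 := hf.coneDim_lt hne
        have h4 : coneDim V γ ≠ n := (h3.trans_le (Nat.lt_succ_iff.1 hτn)).ne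
        rw [h2 γ h4]
        by_cases h : coneDim V τ = n
        · rw [h1 τ h]
          exact (hφ τ hτ h).2.2 γ hγ ⟨hf, hne⟩ y
        · rw [h2 τ h]
          exact hψ.nat τ hτ (hlt hτn h) γ hγ (hlt hγn h4) hf y

theorem exists_isComparison [FiniteDimensional ℝ V] [FiniteDimensional ℝ W]
    (L : LinkSetup Δ F S Λ F') : ∃ ψ, L.IsComparison Δ.cones ψ := by
  obtain ⟨ψ, hψ⟩ := L.exists_isComparison_coneDim_lt (Module.finrank ℝ V + 1)
  exact ⟨ψ, hψ.mono fun τ _ => Nat.lt_succ_iff.2 (Submodule.finrank_le _)⟩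

theorem pPoly_eq [FiniteDimensional ℝ V] [FiniteDimensional ℝ W] (L : LinkSetup Δ F S Λ F') :
    PPoly F Δ.cones = PPoly F' Λ.cones := by
  obtain ⟨ψ, hψ⟩ := L.exists_isComparison
  obtain ⟨Ψ, -, hΨm, hΨd, hΨs⟩ := hψ.secs_comparison (T' := Λ.cones) subset_rfl (by
    rw [L.cones_eq, Set.inter_eq_right.2 fun τ hτ => hτ.1])
  let B : bar F' Λ.cones →ₗ[ℝ] bar F Δ.cones :=
    (mSecs F' Λ.cones).mapQ (mSecs F Δ.cones) Ψ fun g hg => (hΨm g).2 hg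
  have hBQ : ∀ g, B (barQ F' Λ.cones g) = barQ F Δ.cones (Ψ g) := fun g => rfl
  have hQ : ∀ f, barQ F Δ.cones f = 0 ↔ f ∈ mSecs F Δ.cones := fun f =>
    Submodule.Quotient.mk_eq_zero _
  have hQ' : ∀ g, barQ F' Λ.cones g = 0 ↔ g ∈ mSecs F' Λ.cones := fun g =>
    Submodule.Quotient.mk_eq_zero _
  have hB : Function.Injective B := by
    rw [injective_iff_map_eq_zero]
    intro y
    obtain ⟨g, rfl⟩ := Submodule.mkQ_surjective _ y
    intro hg
    exact (hQ' g).2 ((hΨm g).1 ((hQ _).1 hg))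
  have himg : ∀ n, (degSec F Δ.cones n).map (barQ F Δ.cones) =
      ((degSec F' Λ.cones n).map (barQ F' Λ.cones)).map B := by
    intro n
    apply le_antisymm
    · rintro _ ⟨f, hf, rfl⟩
      obtain ⟨g, hg, hgd⟩ := hΨs f
      refine ⟨_, ⟨g, hgd n hf, rfl⟩, ?_⟩
      rw [hBQ, eq_comm, ← sub_eq_zero, ← map_sub, hQ]
      exact hg
    · rintro _ ⟨_, ⟨g, hg, rfl⟩, rfl⟩
      exact ⟨Ψ g, hΨd n g hg, (hBQ g).symm⟩
  unfold PPoly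
  refine finsum_congr fun n => ?_
  rw [himg, LinearEquiv.finrank_eq (Submodule.equivMapOfInjective B hB _).symm]

end LinkSetup

end Link

/-! ## Statement 16:
Let `Δ` be a fan in `ℝ^d` and `σ ∈ Δ` a cone.  Then the Poincaré polynomial of
the simple sheaf based at `σ` on `Δ` equals that of the minimal extension sheaf of
the link `link_Δ σ = {τ̄ : τ ≥ σ}`, a fan in the quotient `ℝ^d/Span(σ)`:
`P(ℒ_σ(Δ)‾; t) = P(ℒ_{link_Δ σ}(link_Δ σ)‾; t)`. -/
theorem poincare_simple_eq_poincare_link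
    (d : ℕ) (Δf : Fan (Fin d → ℝ)) (σ : Set (Fin d → ℝ)) (hσ : σ ∈ Δf.cones)
    -- `F` is the simple sheaf `ℒ_σ` on `Δ`
    (F : SheafData (Fin d → ℝ)) (hF : IsSimple F Δf σ)
    -- `Λ` is the link of `σ` in `Δ`, a fan in `ℝ^d/Span(σ)`
    (Λ : Fan ((Fin d → ℝ) ⧸ Submodule.span ℝ σ))
    (hΛ : Λ.cones =
      (fun τ => (Submodule.span ℝ σ).mkQ '' τ) ''
        {τ | τ ∈ Δf.cones ∧ IsFaceOf (Fin d → ℝ) σ τ})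
    -- `F'` is the minimal extension sheaf of the link
    (F' : SheafData ((Fin d → ℝ) ⧸ Submodule.span ℝ σ))
    (hF' : IsMinExt F' Λ) :
    PPoly F Δf.cones = PPoly F' Λ.cones := by
  obtain ⟨S, hS⟩ := exists_coneSplitting (V := Fin d → ℝ) σ
  have h0 : S.π '' σ = {0} := S.image_self (Δf.pointed σ hσ).1.zero_mem
  have L : LinkSetup Δf F S Λ F' :=
    { mem := hσ
      cones_eq := by
        rw [hΛ, hS]
        rfl
      simple := hF
      simple_link := by
        rw [h0]
        exact hF' }
  exact L.pPoly_eq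

end
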